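/- arXiv:1310.4892 — 3 statements merged into one kernel-verified Lean document; each statement's English description precedes it below -/
import Mathlib

section
/- Let φ : [0,1] → [0,∞) be essentially increasing on [0,1] with φ(1/2) > 0. If there is λ > 0 such that φ(1/2^{2n}) ≥ λ·φ(1/2^n) for every n < ω, then (φ(x))_{x∈[0,1]} ≈ (φ(x²))_{x∈[0,1]}. -/
open Set

/-- `f` is essentially increasing on `D`: for some `C ≥ 1`,
`x ≤ y` implies `f x ≤ C * f y` for `x, y ∈ D`. -/
def EssIncOn (f : ℝ → ℝ) (D : Set ℝ) : Prop :=
  ∃ C : ℝ, 1 ≤ C ∧ ∀ x ∈ D, ∀ y ∈ D, x ≤ y → f x ≤ C * f y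

/-- `(f x)_{x ∈ D} ≈ (g x)_{x ∈ D}`: for some `C ≥ 1`,
`g x / C ≤ f x ≤ C * g x` for all `x ∈ D`. -/
def EquivOn (f g : ℝ → ℝ) (D : Set ℝ) : Prop :=
  ∃ C : ℝ, 1 ≤ C ∧ ∀ x ∈ D, g x / C ≤ f x ∧ f x ≤ C * g x

/-- `(u n) ≈ (v n)`: for some `C ≥ 1`, `v n / C ≤ u n ≤ C * v n` for all `n`. -/
def SeqEquiv (u v : ℕ → ℝ) : Prop :=
  ∃ C : ℝ, 1 ≤ C ∧ ∀ n, v n / C ≤ u n ∧ u n ≤ C * v n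

theorem stmt2 (φ : ℝ → ℝ) (hφnn : ∀ t ∈ Icc (0:ℝ) 1, 0 ≤ φ t)
    (hφei : EssIncOn φ (Icc 0 1)) (hhalf : 0 < φ (1/2))
    (hlam : ∃ lam > (0:ℝ), ∀ n : ℕ, lam * φ ((1/2:ℝ)^n) ≤ φ ((1/2:ℝ)^(2*n))) :
    EquivOn φ (fun t => φ (t^2)) (Icc 0 1) := by
  obtain ⟨C, hC, hinc⟩ := hφei
  obtain ⟨lam, hl, hlam⟩ := hlam
  have hmem : ∀ n : ℕ, ((1/2:ℝ)^n) ∈ Icc (0:ℝ) 1 := fun n =>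
    ⟨by positivity, pow_le_one₀ (by norm_num) (by norm_num)⟩
  have hC0 : 0 < C := by linarith
  have h1 : 0 ≤ φ 1 := hφnn 1 (by simp)
  obtain ⟨B, hB⟩ : ∃ B, B = C / lam + φ 1 / φ (1/2) := ⟨_, rfl⟩
  have hB0 : 0 ≤ B := by rw [hB]; positivity
  have hstep : ∀ n : ℕ, φ ((1/2:ℝ)^n) ≤ B * φ ((1/2:ℝ)^(n+1)) := by
    intro n
    have hp := hφnn _ (hmem (n+1))
    rcases Nat.eq_zero_or_pos n with rfl | hn
    · simp only [pow_zero, zero_add, pow_one]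
      have e : φ 1 / φ (1/2) * φ (1/2) = φ 1 := div_mul_cancel₀ _ hhalf.ne'
      have : 0 ≤ C / lam * φ (1/2) := by positivity
      rw [hB, add_mul, e]
      linarith
    · have a := hlam n
      have b := hinc _ (hmem (2*n)) _ (hmem (n+1))
        (pow_le_pow_of_le_one (by norm_num) (by norm_num) (by omega))
      have c : φ ((1/2:ℝ)^n) ≤ C / lam * φ ((1/2:ℝ)^(n+1)) := by
        rw [div_mul_eq_mul_div, le_div_iff₀ hl]
        linarith
      have : 0 ≤ φ 1 / φ (1/2) * φ ((1/2:ℝ)^(n+1)) := by positivity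
      rw [hB, add_mul]
      linarith
  have hK : 0 ≤ C * B * C / lam := by positivity
  refine ⟨C + C * B * C / lam, by linarith, fun x hx => ?_⟩
  have hx2 : x^2 ∈ Icc (0:ℝ) 1 := ⟨by positivity, pow_le_one₀ hx.1 hx.2⟩
  have hp := hφnn _ hx2
  have hpx := hφnn _ hx
  constructor
  · rw [div_le_iff₀ (by linarith)]
    have := hinc _ hx2 _ hx (by nlinarith [hx.1, hx.2])
    have := mul_nonneg hK hpx
    linarith
  · rcases hx.1.eq_or_lt with h0 | h0
    · subst h0
      have : (0:ℝ)^2 = 0 := by norm_num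
      simp only [this]
      have := mul_nonneg hK hpx
      nlinarith
    · obtain ⟨n, hn1, hn2⟩ := exists_nat_pow_near_of_lt_one h0 hx.2
        (show (0:ℝ) < 1/2 by norm_num) (by norm_num)
      have a := hinc _ hx _ (hmem n) hn2
      have b := hstep n
      have c := hlam (n+1)
      have d := hinc _ (hmem (2*(n+1))) _ hx2 (by
        rw [mul_comm, pow_mul]
        exact pow_le_pow_left₀ (by positivity) hn1.le 2)
      have e : φ ((1/2:ℝ)^(n+1)) ≤ C / lam * φ (x^2) := by
        rw [div_mul_eq_mul_div, le_div_iff₀ hl]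
        linarith
      have f : φ x ≤ C * B * C / lam * φ (x^2) :=
        calc φ x ≤ C * φ ((1/2:ℝ)^n) := a
          _ ≤ C * (B * φ ((1/2:ℝ)^(n+1))) := by gcongr
          _ ≤ C * (B * (C / lam * φ (x^2))) := by gcongr
          _ = _ := by ring
      have := mul_nonneg hC0.le hp
      show φ x ≤ (C + C * B * C / lam) * φ (x^2)
      linarith
end

section
/- Let 1 ≤ α < ∞ and let φ : [0,1] → [0,∞) be continuous and essentially increasing on [0,1] with φ(x) > 0 for x > 0 and lim_{n→∞} φ(1/2^n)/φ(1/2^{n+1}) = 1. Set f(x) = x^α·φ(x) for x ∈ [0,1] and suppose E_f is an equivalence relation on [0,1]^ω. Then for every β with α < β < ∞, E_f is Borel reducible to E_{Id^β}, where Id^β(x) = x^β on [0,1]. -/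
open Set

/-- The relation `E_f` on `[0,1]^ω`: `(x_n) E_f (y_n)` iff `Σ f(|x_n − y_n|) < ∞`
(for `f ≥ 0` this is equivalent to summability). -/
def EF (f : ℝ → ℝ) (x y : ℕ → Icc (0:ℝ) 1) : Prop :=
  Summable fun n => f |(x n : ℝ) - (y n : ℝ)|

/-- Borel reducibility of binary relations. -/
def BorelReducible {X Y : Type*} [MeasurableSpace X] [MeasurableSpace Y]
    (E : X → X → Prop) (F : Y → Y → Prop) : Prop :=
  ∃ θ : X → Y, Measurable θ ∧ ∀ x y, E x y ↔ F (θ x) (θ y)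

/-- The relation `ℝ^ω/ℓ_p`: `x E y` iff `Σ |x_n − y_n|^p < ∞`. -/
def lpRel (p : ℝ) (x y : ℕ → ℝ) : Prop :=
  Summable fun n => |x n - y n| ^ p

lemma aux_sum_bound (d : ℕ → ℝ) (hd : ∀ n, 0 < d n) (q : ℝ) (hq : q < 1) (N : ℕ)
    (h : ∀ n, N ≤ n → d n ≤ q * d (n+1)) :
    ∃ K : ℝ, 0 ≤ K ∧ ∀ m, ∑ n ∈ Finset.range (m+1), d n ≤ K * d m := by
  set S : ℕ → ℝ := fun m => ∑ n ∈ Finset.range (m+1), d n with hS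
  have hSnn : ∀ m, 0 ≤ S m := fun m => Finset.sum_nonneg fun i _ => (hd i).le
  set K1 : ℝ := ∑ m ∈ Finset.range (N+1), S m / d m with hK1
  have hK1nn : 0 ≤ K1 := Finset.sum_nonneg fun i _ => div_nonneg (hSnn i) (hd i).le
  have hq' : 0 < 1 - q := by linarith
  have h1q : 0 < 1 / (1 - q) := by positivity
  set K : ℝ := K1 + 1 / (1 - q) with hK
  have hKq : K * q + 1 ≤ K := by
    have : 1 / (1 - q) * (1 - q) = 1 := by field_simp
    nlinarith
  have hsmall : ∀ m, m ≤ N → S m ≤ K * d m := by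
    intro m hm
    have h1 : S m / d m ≤ K1 :=
      Finset.single_le_sum (f := fun m => S m / d m)
        (fun i _ => div_nonneg (hSnn i) (hd i).le) (Finset.mem_range.2 (by omega))
    rw [div_le_iff₀ (hd m)] at h1
    have := mul_pos h1q (hd m)
    nlinarith
  refine ⟨K, by positivity, fun m => ?_⟩
  rcases le_total m N with hm | hm
  · exact hsmall m hm
  · induction m, hm using Nat.le_induction with
    | base => exact hsmall N le_rfl
    | succ m hm ih =>
      rw [Finset.sum_range_succ]
      have h2 := h m hm
      have h3 : K * d m ≤ K * (q * d (m+1)) := mul_le_mul_of_nonneg_left h2 (by positivity)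
      have h4 := mul_le_mul_of_nonneg_right hKq (hd (m+1)).le
      linarith

noncomputable def auxg (e : Bool) (u : ℝ) : ℝ := if e then Real.sin u else Real.cos u

lemma auxg_bound (e : Bool) (u : ℝ) : |auxg e u| ≤ 1 := by
  unfold auxg; split_ifs
  · exact Real.abs_sin_le_one u
  · exact Real.abs_cos_le_one u

lemma auxg_le2 (e : Bool) (u v : ℝ) : |auxg e u - auxg e v| / 2 ≤ 1 := by
  have h1 := abs_le.1 (auxg_bound e u)
  have h2 := abs_le.1 (auxg_bound e v)
  have : |auxg e u - auxg e v| ≤ 2 := by rw [abs_le]; constructor <;> linarith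
  linarith

lemma auxg_lip (e : Bool) (u v : ℝ) : |auxg e u - auxg e v| / 2 ≤ |u - v| := by
  have key : |2 * Real.sin ((u - v)/2)| ≤ |u - v| := by
    rw [abs_mul, abs_two]
    have := Real.abs_sin_le_abs (x := (u-v)/2)
    rw [abs_div, abs_two] at this
    linarith
  have h0 := abs_nonneg (u - v)
  have : |auxg e u - auxg e v| ≤ |u - v| := by
    unfold auxg; split_ifs
    · rw [Real.sin_sub_sin, abs_mul]
      nlinarith [Real.abs_cos_le_one ((u+v)/2), abs_nonneg (2 * Real.sin ((u - v)/2)),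
        abs_nonneg (Real.cos ((u+v)/2))]
    · rw [Real.cos_sub_cos]
      have : -2 * Real.sin ((u+v)/2) * Real.sin ((u-v)/2)
        = -((2 * Real.sin ((u - v)/2)) * Real.sin ((u+v)/2)) := by ring
      rw [this, abs_neg, abs_mul]
      nlinarith [Real.abs_sin_le_one ((u+v)/2), abs_nonneg (2 * Real.sin ((u - v)/2)),
        abs_nonneg (Real.sin ((u+v)/2))]
  linarith

lemma auxg_low (u v : ℝ) (h1 : 1/2 ≤ |u - v|) (h2 : |u - v| ≤ 1) :
    ∃ e, 1/16 ≤ |auxg e u - auxg e v| / 2 := by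
  have hs : 1/8 ≤ |Real.sin ((u - v)/2)| := by
    have h3 : |Real.sin ((u - v)/2)| = |Real.sin (|u-v|/2)| := by
      rcases abs_cases (u - v) with h | h
      · rw [h.1]
      · rw [h.1, neg_div, Real.sin_neg, abs_neg]
    rw [h3]
    refine le_trans ?_ (le_abs_self _)
    have h4 := Real.mul_le_sin (x := |u-v|/2) (by positivity)
      (by linarith [Real.pi_gt_three])
    have h5 : (1:ℝ)/2 ≤ 2 / Real.pi := by
      rw [div_le_div_iff₀ (by norm_num) Real.pi_pos]; linarith [Real.pi_le_four]
    have h6 : (1:ℝ)/2 * (1/4) ≤ 2 / Real.pi * (|u-v|/2) :=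
      mul_le_mul h5 (by linarith) (by norm_num) (by positivity)
    linarith
  have hsc : 1/2 ≤ |Real.cos ((u+v)/2)| ∨ 1/2 ≤ |Real.sin ((u+v)/2)| := by
    by_contra! hc
    have := Real.sin_sq_add_cos_sq ((u+v)/2)
    rw [← sq_abs (Real.sin _), ← sq_abs (Real.cos _)] at this
    nlinarith [abs_nonneg (Real.sin ((u+v)/2)), abs_nonneg (Real.cos ((u+v)/2))]
  rcases hsc with h | h
  · refine ⟨true, ?_⟩
    simp only [auxg, if_true]
    rw [Real.sin_sub_sin, abs_mul, abs_mul, abs_two]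
    nlinarith
  · refine ⟨false, ?_⟩
    simp only [auxg, Bool.false_eq_true, if_false]
    rw [Real.cos_sub_cos, abs_mul, abs_mul, abs_neg, abs_two]
    nlinarith

noncomputable def auxH (β : ℝ) (b : ℕ → ℝ) (x y : ℝ) (p : ℕ × Bool) : ℝ :=
  b p.1 * (|auxg p.2 (2^p.1 * x) - auxg p.2 (2^p.1 * y)| / 2) ^ β

lemma auxH_nonneg (β : ℝ) (b : ℕ → ℝ) (hb : ∀ n, 0 < b n) (x y : ℝ) (p : ℕ × Bool) :
    0 ≤ auxH β b x y p := mul_nonneg (hb _).le (Real.rpow_nonneg (by positivity) _)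

/-- Core estimate. -/
lemma aux_core (β : ℝ) (hβ : 0 < β) (b : ℕ → ℝ) (hb : ∀ n, 0 < b n) (C K : ℝ)
    (hK : ∀ m, ∑ n ∈ Finset.range (m+1), ((2:ℝ)^n) ^ β * b n ≤ K * (((2:ℝ)^m) ^ β * b m))
    (hC : ∀ m k, b (m + k) ≤ C * b m * (1/2) ^ k)
    (x y : ℝ) (m : ℕ) (h1 : (1/2:ℝ)^(m+1) < |x - y|) (h2 : |x - y| ≤ (1/2:ℝ)^m) :
    Summable (auxH β b x y) ∧ (1/16) ^ β * b m ≤ ∑' p, auxH β b x y p ∧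
      ∑' p, auxH β b x y p ≤ 2 * (K + 2 * C) * b m := by
  have hC0 : 0 ≤ C := by
    have := hC 0 0
    have h0 := hb 0
    simp only [add_zero, pow_zero, mul_one] at this
    by_contra! hc
    nlinarith
  have hnn := auxH_nonneg β b hb x y
  have hle1 : ∀ n e, auxH β b x y (n, e) ≤ b n := by
    intro n e
    have : (|auxg e (2^n * x) - auxg e (2^n * y)| / 2) ^ β ≤ 1 :=
      Real.rpow_le_one (by positivity) (auxg_le2 _ _ _) hβ.le
    simpa [auxH] using mul_le_mul_of_nonneg_left this (hb n).le
  have hle2 : ∀ n e, auxH β b x y (n, e) ≤ (((2:ℝ)^n) ^ β * b n) * ((1/2:ℝ)^m)^β := by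
    intro n e
    have h3 : (|auxg e (2^n * x) - auxg e (2^n * y)| / 2) ≤ 2^n * (1/2:ℝ)^m := by
      refine (auxg_lip _ _ _).trans ?_
      rw [← mul_sub, abs_mul, abs_of_nonneg (by positivity : (0:ℝ) ≤ 2^n)]
      gcongr
    have h4 := Real.rpow_le_rpow (by positivity) h3 hβ.le
    rw [Real.mul_rpow (by positivity) (by positivity)] at h4
    have := mul_le_mul_of_nonneg_left h4 (hb n).le
    simp only [auxH]
    linarith
  set M : ℕ → ℝ := fun n => auxH β b x y (n, true) + auxH β b x y (n, false) with hM
  have hMnn : ∀ n, 0 ≤ M n := fun n => add_nonneg (hnn _) (hnn _)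
  have hcancel : ((2:ℝ)^m)^β * ((1/2:ℝ)^m)^β = 1 := by
    rw [← Real.mul_rpow (by positivity) (by positivity), ← mul_pow]
    norm_num
  have hpart : ∀ N, ∑ n ∈ Finset.range N, M n ≤ 2 * (K + 2 * C) * b m := by
    intro N
    have e1 : ∑ n ∈ Finset.range N, M n ≤ ∑ n ∈ Finset.range (m + 1 + N), M n :=
      Finset.sum_le_sum_of_subset_of_nonneg
        (Finset.range_mono (by omega)) (fun i _ _ => hMnn i)
    rw [Finset.sum_range_add] at e1
    have e2 : ∑ n ∈ Finset.range (m+1), M n ≤ 2 * (K * b m) := by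
      calc ∑ n ∈ Finset.range (m+1), M n
          ≤ ∑ n ∈ Finset.range (m+1), (((2:ℝ)^n) ^ β * b n) * (2 * ((1/2:ℝ)^m)^β) := by
            refine Finset.sum_le_sum fun n _ => ?_
            have := hle2 n true
            have := hle2 n false
            simp only [hM]
            linarith
        _ = (∑ n ∈ Finset.range (m+1), ((2:ℝ)^n) ^ β * b n) * (2 * ((1/2:ℝ)^m)^β) := by
            rw [Finset.sum_mul]
        _ ≤ K * (((2:ℝ)^m) ^ β * b m) * (2 * ((1/2:ℝ)^m)^β) :=
            mul_le_mul_of_nonneg_right (hK m) (by positivity)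
        _ = 2 * (K * b m) * (((2:ℝ)^m)^β * ((1/2:ℝ)^m)^β) := by ring
        _ = 2 * (K * b m) := by rw [hcancel, mul_one]
    have e3 : ∑ k ∈ Finset.range N, M (m + 1 + k) ≤ 2 * (2 * C * b m) := by
      calc ∑ k ∈ Finset.range N, M (m + 1 + k)
          ≤ ∑ k ∈ Finset.range N, (2 * (C * b m)) * (1/2:ℝ)^k := by
            refine Finset.sum_le_sum fun k _ => ?_
            have a1 := hle1 (m+1+k) true
            have a2 := hle1 (m+1+k) false
            have a3 := hC m (1+k)
            rw [← add_assoc, pow_add] at a3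
            have a4 : 0 ≤ C * b m * (1/2:ℝ)^k :=
              mul_nonneg (mul_nonneg hC0 (hb m).le) (by positivity)
            simp only [hM]
            nlinarith
        _ = (2 * (C * b m)) * ∑ k ∈ Finset.range N, (1/2:ℝ)^k := by rw [Finset.mul_sum]
        _ ≤ (2 * (C * b m)) * 2 := by
            refine mul_le_mul_of_nonneg_left ?_
              (mul_nonneg (by norm_num) (mul_nonneg hC0 (hb m).le))
            exact sum_geometric_two_le N
        _ = _ := by ring
    linarith
  have hMs : Summable M := summable_of_sum_range_le hMnn hpart
  have hsum : Summable (auxH β b x y) := by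
    rw [summable_prod_of_nonneg hnn]
    refine ⟨fun n => (hasSum_fintype _).summable, ?_⟩
    simpa [tsum_fintype, hM] using hMs
  refine ⟨hsum, ?_, ?_⟩
  · obtain ⟨e, he⟩ := auxg_low (2^m * x) (2^m * y) (by
      rw [← mul_sub, abs_mul, abs_of_nonneg (by positivity : (0:ℝ) ≤ 2^m)]
      have := mul_le_mul_of_nonneg_left h1.le (by positivity : (0:ℝ) ≤ 2^m)
      refine le_trans (le_of_eq ?_) this
      rw [pow_succ, ← mul_assoc, ← mul_pow]; norm_num) (by
      rw [← mul_sub, abs_mul, abs_of_nonneg (by positivity : (0:ℝ) ≤ 2^m)]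
      have := mul_le_mul_of_nonneg_left h2 (by positivity : (0:ℝ) ≤ 2^m)
      refine le_trans this (le_of_eq ?_)
      rw [← mul_pow]; norm_num)
    refine le_trans ?_ (hsum.le_tsum (m, e) fun p _ => hnn p)
    have := mul_le_mul_of_nonneg_left (Real.rpow_le_rpow (by norm_num) he hβ.le) (hb m).le
    simp only [auxH]
    linarith
  · rw [hsum.tsum_prod' fun n => (hasSum_fintype _).summable]
    have : ∀ n, ∑' e, auxH β b x y (n, e) = M n := by
      intro n; simp [tsum_fintype, hM]
    simp only [this]
    exact Real.tsum_le_of_sum_range_le hMnn hpart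

/-- Properties of the dyadic coefficients. -/
lemma aux_coef (α β : ℝ) (hα : 1 ≤ α) (hβ : α < β) (φ : ℝ → ℝ)
    (hφei : EssIncOn φ (Icc 0 1))
    (hφpos : ∀ t ∈ Ioc (0:ℝ) 1, 0 < φ t)
    (hlim : Filter.Tendsto (fun n : ℕ => φ ((1/2:ℝ)^n) / φ ((1/2:ℝ)^(n+1)))
      Filter.atTop (nhds 1)) :
    ∃ b : ℕ → ℝ, (∀ n, 0 < b n) ∧ ∃ C K D : ℝ, 0 < C ∧ 0 < D ∧ 0 ≤ K ∧
    (∀ m, ∑ n ∈ Finset.range (m+1), ((2:ℝ)^n) ^ β * b n ≤ K * (((2:ℝ)^m) ^ β * b m)) ∧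
    (∀ m k, b (m + k) ≤ C * b m * (1/2) ^ k) ∧
    (∀ m t, (1/2:ℝ)^(m+1) < t → t ≤ (1/2:ℝ)^m →
      t ^ α * φ t ≤ C * b m ∧ b m ≤ D * (t ^ α * φ t)) := by
  obtain ⟨C, hC1, hC⟩ := hφei
  have hC0 : 0 < C := by linarith
  have hs : ∀ n : ℕ, (1/2:ℝ)^n ∈ Icc (0:ℝ) 1 := fun n =>
    ⟨by positivity, pow_le_one₀ (by norm_num) (by norm_num)⟩
  have hA : ∀ n : ℕ, 0 < φ ((1/2:ℝ)^n) := fun n => hφpos _ ⟨by positivity, (hs n).2⟩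
  set b : ℕ → ℝ := fun n => ((1/2:ℝ)^n)^α * φ ((1/2:ℝ)^n) with hbdef
  have hb : ∀ n, 0 < b n := fun n => mul_pos (by positivity) (hA n)
  -- bounded ratios
  obtain ⟨R, hR⟩ := hlim.bddAbove_range
  have hR' : ∀ n, φ ((1/2:ℝ)^n) ≤ R * φ ((1/2:ℝ)^(n+1)) := by
    intro n
    rw [← div_le_iff₀ (hA (n+1))]
    exact hR ⟨n, rfl⟩
  have hR0 : 0 < R := by
    have h1 := hR' 0
    by_contra! hc
    nlinarith [hA 0, hA 1]
  -- sums
  set r : ℝ := (1/2:ℝ)^(β-α) with hr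
  have hr1 : r < 1 := Real.rpow_lt_one (by norm_num) (by norm_num) (by linarith)
  have hr0 : 0 < r := by positivity
  obtain ⟨q, hq1, hq2⟩ := exists_between hr1
  have hq0 : 0 < q := hr0.trans hq1
  have hev : ∀ᶠ n : ℕ in Filter.atTop, φ ((1/2:ℝ)^n) / φ ((1/2:ℝ)^(n+1)) < q / r :=
    hlim.eventually_lt_const ((one_lt_div hr0).2 hq1)
  obtain ⟨N, hN⟩ := Filter.eventually_atTop.1 hev
  have hd : ∀ n : ℕ, ((2:ℝ)^n)^β * b n = ((2:ℝ)^(β-α))^n * φ ((1/2:ℝ)^n) := by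
    intro n
    have e1 : ((1/2:ℝ)^n)^α = (((2:ℝ)^n)^α)⁻¹ := by
      rw [one_div, inv_pow, Real.inv_rpow (by positivity)]
    simp only [hbdef]
    rw [e1, ← mul_assoc, ← div_eq_mul_inv, ← Real.rpow_sub (by positivity)]
    congr 1
    rw [← Real.rpow_natCast, ← Real.rpow_natCast, ← Real.rpow_mul (by norm_num),
      ← Real.rpow_mul (by norm_num), mul_comm (n:ℝ)]
  have hr2 : r * (2:ℝ)^(β-α) = 1 := by
    rw [hr, ← Real.mul_rpow (by norm_num) (by norm_num)]; norm_num
  obtain ⟨K, hK0, hK⟩ := aux_sum_bound (fun n => ((2:ℝ)^n)^β * b n)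
    (fun n => mul_pos (by positivity) (hb n)) q hq2 N (by
      intro n hn
      have h1 := (hN n hn).le
      rw [div_le_div_iff₀ (hA (n+1)) hr0] at h1
      simp only [hd]
      have hp : 0 < ((2:ℝ)^(β-α))^n := by positivity
      have hp' : 0 < (2:ℝ)^(β-α) := by positivity
      have h2 := mul_le_mul_of_nonneg_left h1 (mul_pos hp hp').le
      calc ((2:ℝ)^(β-α))^n * φ ((1/2:ℝ)^n)
          = ((2:ℝ)^(β-α))^n * φ ((1/2:ℝ)^n) * (r * (2:ℝ)^(β-α)) := by rw [hr2, mul_one]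
        _ = ((2:ℝ)^(β-α))^n * (2:ℝ)^(β-α) * (φ ((1/2:ℝ)^n) * r) := by ring
        _ ≤ _ := h2
        _ = _ := by rw [pow_succ]; ring)
  refine ⟨b, hb, C, K, 2^α * R * C, hC0, by positivity, hK0, hK, ?_, ?_⟩
  · intro m k
    have h1 : φ ((1/2:ℝ)^(m+k)) ≤ C * φ ((1/2:ℝ)^m) :=
      hC _ (hs _) _ (hs _) (pow_le_pow_of_le_one (by norm_num) (by norm_num) (by omega))
    have h2 : ((1/2:ℝ)^(m+k))^α ≤ ((1/2:ℝ)^m)^α * (1/2)^k := by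
      rw [pow_add, Real.mul_rpow (by positivity) (by positivity)]
      refine mul_le_mul_of_nonneg_left ?_ (by positivity)
      exact Real.rpow_le_self_of_le_one (hs k).1 (hs k).2 hα
    calc b (m+k) ≤ (((1/2:ℝ)^m)^α * (1/2)^k) * (C * φ ((1/2:ℝ)^m)) :=
          mul_le_mul h2 h1 (hA _).le (by positivity)
      _ = _ := by simp only [hbdef]; ring
  · intro m t h1 h2
    have hpos : (0:ℝ) < (1/2)^(m+1) := by positivity
    have ht0 : 0 < t := hpos.trans h1
    have ht : t ∈ Icc (0:ℝ) 1 := ⟨ht0.le, h2.trans (hs m).2⟩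
    constructor
    · have e1 := hC t ht _ (hs m) h2
      have e2 : t^α ≤ ((1/2:ℝ)^m)^α := Real.rpow_le_rpow ht0.le h2 (by linarith)
      calc t^α * φ t ≤ ((1/2:ℝ)^m)^α * (C * φ ((1/2:ℝ)^m)) :=
            mul_le_mul e2 e1 (hφpos t ⟨ht0, ht.2⟩).le (by positivity)
        _ = _ := by simp only [hbdef]; ring
    · have e1 := hC _ (hs (m+1)) t ht h1.le
      have e2 : ((1/2:ℝ)^m)^α ≤ 2^α * t^α := by
        rw [← Real.mul_rpow (by norm_num) ht0.le]
        refine Real.rpow_le_rpow (by positivity) ?_ (by linarith)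
        rw [pow_succ] at h1; linarith
      have e3 : φ ((1/2:ℝ)^m) ≤ R * (C * φ t) :=
        (hR' m).trans (mul_le_mul_of_nonneg_left e1 hR0.le)
      calc b m ≤ (2^α * t^α) * (R * (C * φ t)) :=
            mul_le_mul e2 e3 (hA m).le (by positivity)
        _ = _ := by ring

theorem stmt10 (α : ℝ) (hα : 1 ≤ α) (φ : ℝ → ℝ)
    (hφc : ContinuousOn φ (Icc 0 1)) (hφei : EssIncOn φ (Icc 0 1))
    (hφnn : ∀ t ∈ Icc (0:ℝ) 1, 0 ≤ φ t)
    (hφpos : ∀ t ∈ Ioc (0:ℝ) 1, 0 < φ t)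
    (hlim : Filter.Tendsto (fun n : ℕ => φ ((1/2:ℝ)^n) / φ ((1/2:ℝ)^(n+1)))
      Filter.atTop (nhds 1))
    (hEf : Equivalence (EF (fun t => t ^ α * φ t))) :
    ∀ β : ℝ, α < β →
      BorelReducible (EF (fun t => t ^ α * φ t)) (EF (fun t => t ^ β)) := by
  intro β hβ
  have hβ0 : 0 < β := by linarith
  obtain ⟨b, hb, C, K, D, hC0, hD0, hK0, hK, hC, hf⟩ :=
    aux_coef α β hα hβ φ hφei hφpos hlim
  -- two-sided estimate
  have hest : ∀ x y : Icc (0:ℝ) 1,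
      Summable (auxH β b x y) ∧
      (|(x:ℝ) - y| ^ α * φ |(x:ℝ) - y| ≤ (C * 16 ^ β) * ∑' p, auxH β b x y p) ∧
      ∑' p, auxH β b x y p ≤
        (2 * (K + 2 * C) * D) * (|(x:ℝ) - y| ^ α * φ |(x:ℝ) - y|) := by
    intro x y
    rcases eq_or_ne x y with rfl | hne
    · have h0 : auxH β b x x = fun _ => 0 := by
        funext p; simp [auxH, Real.zero_rpow hβ0.ne']
      rw [h0]
      have : α ≠ 0 := by linarith
      simp [Real.zero_rpow this, summable_zero]
    · have hpos : 0 < |(x:ℝ) - y| := abs_pos.2 (sub_ne_zero.2 fun h => hne (Subtype.ext h))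
      have hle : |(x:ℝ) - y| ≤ 1 := by
        have := x.2.1; have := x.2.2; have := y.2.1; have := y.2.2
        rw [abs_le]; constructor <;> linarith
      obtain ⟨m, h1, h2⟩ := exists_nat_pow_near_of_lt_one hpos hle
        (by norm_num : (0:ℝ) < 1/2) (by norm_num)
      obtain ⟨s1, s2, s3⟩ := aux_core β hβ0 b hb C K hK hC x y m h1 h2
      obtain ⟨f1, f2⟩ := hf m _ h1 h2
      refine ⟨s1, ?_, ?_⟩
      · have hc : (16:ℝ)^β * (1/16)^β = 1 := by
          rw [← Real.mul_rpow (by norm_num) (by norm_num)]; norm_num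
        calc _ ≤ C * b m := f1
          _ = C * (16:ℝ)^β * ((1/16)^β * b m) := by
            rw [mul_assoc, ← mul_assoc ((16:ℝ)^β), hc, one_mul]
          _ ≤ _ := mul_le_mul_of_nonneg_left s2 (by positivity)
      · calc _ ≤ _ := s3
          _ ≤ 2 * (K + 2 * C) * (D * (|(x:ℝ) - y| ^ α * φ |(x:ℝ) - y|)) :=
            mul_le_mul_of_nonneg_left f2 (by positivity)
          _ = _ := by ring
  -- normalisation
  set B : ℝ := C * b 0 with hB
  have hB0 : 0 < B := mul_pos hC0 (hb 0)
  have hbB : ∀ n, b n / B ≤ 1 := by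
    intro n
    rw [div_le_one hB0]
    have h1 := hC 0 n
    rw [zero_add] at h1
    refine h1.trans ?_
    exact mul_le_of_le_one_right hB0.le (pow_le_one₀ (by norm_num) (by norm_num))
  set a : ℕ → ℝ := fun n => (b n / B) ^ (1/β) with ha
  have ha0 : ∀ n, 0 ≤ a n := fun n => Real.rpow_nonneg (div_pos (hb n) hB0).le _
  have ha1 : ∀ n, a n ≤ 1 := fun n =>
    Real.rpow_le_one (div_pos (hb n) hB0).le (hbB n) (by positivity)
  have haβ : ∀ n, (a n) ^ β = b n / B := by
    intro n
    simp only [ha]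
    rw [← Real.rpow_mul (div_pos (hb n) hB0).le, one_div_mul_cancel hβ0.ne', Real.rpow_one]
  let ι := ℕ × (ℕ × Bool)
  obtain ⟨hden⟩ := nonempty_denumerable (ℕ × (ℕ × Bool))
  let e : ℕ ≃ ι := (Denumerable.eqv (ℕ × (ℕ × Bool))).symm
  let w : ι → (ℕ → Icc (0:ℝ) 1) → ℝ := fun i x =>
    a i.2.1 * ((1 + auxg i.2.2 (2 ^ i.2.1 * (x i.1 : ℝ))) / 2)
  have hw : ∀ i x, w i x ∈ Icc (0:ℝ) 1 := by
    intro i x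
    have := abs_le.1 (auxg_bound i.2.2 (2 ^ i.2.1 * (x i.1 : ℝ)))
    refine ⟨mul_nonneg (ha0 _) (by linarith), ?_⟩
    exact mul_le_one₀ (ha1 _) (by linarith) (by linarith)
  have hwm : ∀ i, Measurable (w i) := by
    rintro ⟨j, n, ε⟩
    have hx : Measurable fun x : ℕ → Icc (0:ℝ) 1 => (2:ℝ)^n * (x j : ℝ) :=
      (measurable_subtype_coe.comp (measurable_pi_apply j)).const_mul _
    have hg : Measurable (auxg ε) := by
      cases ε
      · rw [show auxg false = Real.cos from by funext u; simp [auxg]]; exact Real.measurable_cos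
      · rw [show auxg true = Real.sin from by funext u; simp [auxg]]; exact Real.measurable_sin
    exact (((hg.comp hx).const_add 1).div_const 2).const_mul _
  refine ⟨fun x k => ⟨w (e k) x, hw _ _⟩, ?_, ?_⟩
  · exact measurable_pi_lambda _ fun k => (hwm (e k)).subtype_mk
  · intro x y
    have hterm : ∀ i : ι, |w i x - w i y| ^ β = auxH β b (x i.1) (y i.1) i.2 / B := by
      intro i
      have : w i x - w i y = a i.2.1 * ((auxg i.2.2 (2 ^ i.2.1 * (x i.1 : ℝ))
          - auxg i.2.2 (2 ^ i.2.1 * (y i.1 : ℝ))) / 2) := by simp only [w]; ring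
      rw [this, abs_mul, abs_of_nonneg (ha0 _), Real.mul_rpow (ha0 _) (abs_nonneg _), haβ,
        abs_div, abs_two, auxH]
      ring
    have hfnn : ∀ n, 0 ≤ |(x n:ℝ) - y n| ^ α * φ |(x n:ℝ) - y n| := by
      intro n
      refine mul_nonneg (by positivity) (hφnn _ ⟨abs_nonneg _, ?_⟩)
      have := (x n).2.1; have := (x n).2.2; have := (y n).2.1; have := (y n).2.2
      rw [abs_le]; constructor <;> linarith
    have hT : ∀ n, 0 ≤ ∑' p, auxH β b (x n) (y n) p := fun n =>
      tsum_nonneg fun p => auxH_nonneg β b hb _ _ p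
    have hR : EF (fun t => t ^ β) (fun k => ⟨w (e k) x, hw _ _⟩)
        (fun k => ⟨w (e k) y, hw _ _⟩) ↔
        Summable fun n => ∑' p, auxH β b (x n) (y n) p := by
      have h1 : Summable (fun k => |w (e k) x - w (e k) y| ^ β) ↔
          Summable (fun i : ι => |w i x - w i y| ^ β) :=
        e.summable_iff (f := fun i : ι => |w i x - w i y| ^ β)
      have h2 : Summable (fun i : ι => auxH β b (x i.1) (y i.1) i.2 / B) ↔
          Summable (fun i : ι => auxH β b (x i.1) (y i.1) i.2) := by
        simp only [div_eq_mul_inv]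
        exact summable_mul_right_iff (inv_ne_zero hB0.ne')
      simp only [EF]
      rw [h1]
      simp only [hterm]
      rw [h2, summable_prod_of_nonneg (fun i => auxH_nonneg β b hb _ _ _)]
      exact ⟨fun h => h.2, fun h => ⟨fun n => (hest (x n) (y n)).1, h⟩⟩
    rw [hR]
    constructor
    · intro h
      exact Summable.of_nonneg_of_le hT (fun n => (hest (x n) (y n)).2.2) (h.mul_left _)
    · intro h
      exact Summable.of_nonneg_of_le hfnn (fun n => (hest (x n) (y n)).2.1) (h.mul_left _)
end

section
/- Let α ≥ 1. Fix the data: a_0 = 0, a_{l+1} = a_l + 1 + l·a_l and I_l = [a_l, a_{l+1}) ∩ ω; a sequence (δ_m)_{m<ω} in (0,1) with 0 < inf_m δ_m ≤ sup_m δ_m < 1; a strictly increasing sequence (k_m)_{m<ω} of natural numbers with k_0 ≥ 2 and k_{m+1} ≥ 2·k_m. For U ⊆ ω define u_U(0) = 1 and, for n > 0, u_U(n) = δ_m·u_U(n−1) if n = k_m for some m ∈ I_l with l ∈ U, and u_U(n) = u_U(n−1) otherwise. Let φ : [0,1] → [0,∞) be continuous and essentially increasing on [0,1] with φ(x) > 0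 for x > 0, and suppose there is λ > 0 with φ(x²) ≥ λ·φ(x) for all x ∈ [0,1]. For each U ⊆ ω let φ_U : [0,1] → [0,∞) be a continuous increasing function with φ_U(1/2^n) = u_U(n) for every n < ω, and set f_U(x) = x^α·φ(x)·φ_U(x) for x ∈ [0,1]. Then E_{f_U} is an equivalence relation on [0,1]^ω, and for all U, V ⊆ ω: U ⊆* V if and only if E_{f_U} ≤_B E_{f_V}. -/
open Set

/-! ### Slowly varying functions -/

structure Slow (ψ : ℝ → ℝ) : Prop where
  cont : ContinuousOn ψ (Icc 0 1)
  nn : ∀ t ∈ Icc (0:ℝ) 1, 0 ≤ ψ t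
  pos : ∀ t ∈ Ioc (0:ℝ) 1, 0 < ψ t
  slow : ∃ C : ℝ, 1 ≤ C ∧ ∀ x ∈ Icc (0:ℝ) 1, ∀ t ∈ Icc (0:ℝ) 1, x ^ 2 ≤ t → ψ x ≤ C * ψ t

noncomputable def Fn (α : ℝ) (ψ : ℝ → ℝ) (t : ℝ) : ℝ := t ^ α * ψ t

lemma Slow.scale {ψ : ℝ → ℝ} (h : Slow ψ) (σ : ℝ) (hσ : 0 < σ) (hσ1 : σ ≤ 1) :
    ∃ C : ℝ, 1 ≤ C ∧ ∀ x ∈ Icc (0:ℝ) 1, ∀ t ∈ Icc (0:ℝ) 1, σ * x ≤ t → ψ x ≤ C * ψ t := by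
  obtain ⟨C, hC, hs⟩ := h.slow
  have hσp : 0 < ψ σ := h.pos σ ⟨hσ, hσ1⟩
  have h1p : 0 < ψ 1 := h.pos 1 ⟨by norm_num, le_rfl⟩
  refine ⟨max C (C * (ψ 1 / ψ σ) * C), le_max_of_le_left hC, fun x hx t ht hxt => ?_⟩
  have htn := h.nn t ht
  rcases le_or_gt x σ with hxs | hxs
  · have h1 : x ^ 2 ≤ t := by nlinarith [hx.1]
    exact (hs x hx t ht h1).trans (mul_le_mul_of_nonneg_right (le_max_left _ _) htn)
  · have h1 : σ ^ 2 ≤ t := by nlinarith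
    have h2 := hs σ ⟨hσ.le, hσ1⟩ t ht h1
    have h3 := hs x hx 1 ⟨by norm_num, le_rfl⟩ (by nlinarith [hx.1, hx.2])
    have h4 : ψ 1 = ψ 1 / ψ σ * ψ σ := by field_simp
    calc ψ x ≤ C * ψ 1 := h3
      _ = C * (ψ 1 / ψ σ) * ψ σ := by rw [mul_assoc, ← h4]
      _ ≤ C * (ψ 1 / ψ σ) * (C * ψ t) := by gcongr
      _ = (C * (ψ 1 / ψ σ) * C) * ψ t := by ring
      _ ≤ _ := mul_le_mul_of_nonneg_right (le_max_right _ _) htn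

lemma Fn_zero {α : ℝ} (hα : 1 ≤ α) (ψ : ℝ → ℝ) : Fn α ψ 0 = 0 := by
  simp [Fn, Real.zero_rpow (by linarith : α ≠ 0)]

lemma Fn_nn {α : ℝ} {ψ : ℝ → ℝ} (h : Slow ψ) : ∀ t ∈ Icc (0:ℝ) 1, 0 ≤ Fn α ψ t :=
  fun t ht => mul_nonneg (Real.rpow_nonneg ht.1 _) (h.nn t ht)

lemma Fn_pos {α : ℝ} {ψ : ℝ → ℝ} (h : Slow ψ) : ∀ t ∈ Ioc (0:ℝ) 1, 0 < Fn α ψ t :=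
  fun t ht => mul_pos (Real.rpow_pos_of_pos ht.1 _) (h.pos t ht)

lemma Fn_cont {α : ℝ} (hα : 1 ≤ α) {ψ : ℝ → ℝ} (h : Slow ψ) : ContinuousOn (Fn α ψ) (Icc 0 1) :=
  ContinuousOn.mul (Real.continuous_rpow_const (by linarith)).continuousOn h.cont

lemma Fn_ei {α : ℝ} (hα : 1 ≤ α) {ψ : ℝ → ℝ} (h : Slow ψ) :
    ∃ C : ℝ, 1 ≤ C ∧ ∀ x y, 0 ≤ x → x ≤ y → y ≤ 1 → Fn α ψ x ≤ C * Fn α ψ y := by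
  obtain ⟨C, hC, hs⟩ := h.slow
  refine ⟨C, hC, fun x y hx hxy hy => ?_⟩
  have h1 := hs x ⟨hx, hxy.trans hy⟩ y ⟨hx.trans hxy, hy⟩ (by nlinarith)
  have h0 := h.nn x ⟨hx, hxy.trans hy⟩
  have h2 : x ^ α ≤ y ^ α := Real.rpow_le_rpow hx hxy (by linarith)
  calc Fn α ψ x ≤ y ^ α * (C * ψ y) := mul_le_mul h2 h1 h0 (Real.rpow_nonneg (hx.trans hxy) _)
    _ = _ := by unfold Fn; ring

lemma Fn_half {α : ℝ} (hα : 1 ≤ α) {ψ : ℝ → ℝ} (h : Slow ψ) (σ : ℝ) (hσ : 0 < σ) (hσ1 : σ ≤ 1) :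
    ∃ C : ℝ, 1 ≤ C ∧ ∀ x ∈ Icc (0:ℝ) 1, ∀ t ∈ Icc (0:ℝ) 1, σ * x ≤ t →
      Fn α ψ x ≤ C * Fn α ψ t := by
  obtain ⟨C, hC, hs⟩ := h.scale σ hσ hσ1
  have hσα : 1 ≤ (σ⁻¹) ^ α := Real.one_le_rpow ((one_le_inv₀ hσ).2 hσ1) (by linarith)
  refine ⟨(σ⁻¹) ^ α * C, by nlinarith, fun x hx t ht hxt => ?_⟩
  have h1 := hs x hx t ht hxt
  have h0 := h.nn x hx
  have h2 : x ^ α ≤ (σ⁻¹) ^ α * t ^ α := by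
    rw [← Real.mul_rpow (by positivity) ht.1]
    apply Real.rpow_le_rpow hx.1 _ (by linarith)
    rw [← div_eq_inv_mul, le_div_iff₀ hσ]; linarith
  calc Fn α ψ x ≤ ((σ⁻¹) ^ α * t ^ α) * (C * ψ t) :=
        mul_le_mul h2 h1 h0 (mul_nonneg (by positivity) (Real.rpow_nonneg ht.1 _))
    _ = _ := by unfold Fn; ring

lemma abs_sub_mem {a b : ℝ} (ha : a ∈ Icc (0:ℝ) 1) (hb : b ∈ Icc (0:ℝ) 1) :
    |a - b| ∈ Icc (0:ℝ) 1 :=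
  ⟨abs_nonneg _, abs_le.2 ⟨by linarith [ha.1, hb.2], by linarith [ha.2, hb.1]⟩⟩

def PTri (K : ℝ) (g : ℝ → ℝ) : Prop :=
  ∀ a ∈ Icc (0:ℝ) 1, ∀ b ∈ Icc (0:ℝ) 1, ∀ c ∈ Icc (0:ℝ) 1,
    g |a - c| ≤ K * (g |a - b| + g |b - c|)

lemma Fn_tri {α : ℝ} (hα : 1 ≤ α) {ψ : ℝ → ℝ} (h : Slow ψ) :
    ∃ K : ℝ, 1 ≤ K ∧ PTri K (Fn α ψ) := by
  obtain ⟨C, hC, hs⟩ := Fn_half hα h (1/2) (by norm_num) (by norm_num)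
  refine ⟨C, hC, fun a ha b hb c hc => ?_⟩
  have hab := abs_sub_mem ha hb
  have hbc := abs_sub_mem hb hc
  have hac := abs_sub_mem ha hc
  have h1 := Fn_nn (α := α) h _ hab
  have h2 := Fn_nn (α := α) h _ hbc
  have htri := abs_sub_le a b c
  rcases le_total (|a - b|) (|b - c|) with hle | hle
  · have := hs _ hac _ hbc (by linarith)
    nlinarith
  · have := hs _ hac _ hab (by linarith)
    nlinarith

lemma EF_equiv {g : ℝ → ℝ} (h0 : g 0 = 0) (hnn : ∀ t ∈ Icc (0:ℝ) 1, 0 ≤ g t)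
    {K : ℝ} (hK : PTri K g) : Equivalence (EF g) := by
  refine ⟨fun x => ?_, fun {x y} hxy => ?_, fun {x y z} hxy hyz => ?_⟩
  · simp [EF, h0, summable_zero]
  · unfold EF at *
    simpa only [abs_sub_comm] using hxy
  · unfold EF at *
    refine Summable.of_nonneg_of_le (fun n => hnn _ (abs_sub_mem (x n).2 (z n).2))
      (fun n => hK _ (x n).2 _ (y n).2 _ (z n).2) ((hxy.add hyz).mul_left K)

/-! ### Baire category -/

lemma exists_residual_continuousOn {X Y : Type*} [TopologicalSpace X] [MeasurableSpace X]
    [BorelSpace X] [TopologicalSpace Y] [SecondCountableTopology Y] [MeasurableSpace Y]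
    [OpensMeasurableSpace Y] (Θ : X → Y) (hΘ : Measurable Θ) :
    ∃ C ∈ residual X, ContinuousOn Θ C := by
  have hB := TopologicalSpace.isBasis_countableBasis Y
  have h1 : ∀ U : TopologicalSpace.countableBasis Y, ∃ u : Set X, IsOpen u ∧
      ∀ᶠ x in residual X, (x ∈ Θ ⁻¹' U.1 ↔ x ∈ u) := by
    intro U
    obtain ⟨u, hu, he⟩ := (hΘ (hB.isOpen U.2).measurableSet).residualEq_isOpen
    exact ⟨u, hu, he.mem_iff⟩
  choose u huo hu using h1
  have hc : Countable (TopologicalSpace.countableBasis Y) :=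
    (TopologicalSpace.countable_countableBasis Y).to_subtype
  refine ⟨{x | ∀ U, (x ∈ Θ ⁻¹' U.1 ↔ x ∈ u U)}, eventually_countable_forall.2 hu, ?_⟩
  intro x hx
  rw [ContinuousWithinAt, hB.nhds_hasBasis.tendsto_right_iff]
  rintro U ⟨hU, hxU⟩
  have hxu : x ∈ u ⟨U, hU⟩ := (hx ⟨U, hU⟩).1 hxU
  filter_upwards [mem_nhdsWithin_of_mem_nhds ((huo ⟨U, hU⟩).mem_nhds hxu), self_mem_nhdsWithin]
    with y hy hyC
  exact (hyC ⟨U, hU⟩).2 hy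

def tp (n : ℕ) : ℕ := (Nat.unpair n).1

abbrev ZZ : Type := ∀ n : ℕ, Fin (2 ^ tp n + 1)

def ov (p : ℕ) (v y : ZZ) : ZZ := fun n => if n < p then v n else y n

lemma ov_congr {p : ℕ} {v v' y y' : ZZ} (h : ∀ n < p, v n = v' n) (h' : ∀ n, p ≤ n → y n = y' n) :
    ov p v y = ov p v' y' := by
  funext n
  unfold ov
  split_ifs with hn
  · exact h n hn
  · exact h' n (not_lt.1 hn)

lemma ov_self (p : ℕ) (y : ZZ) : ov p y y = y := by
  funext n; unfold ov; split_ifs <;> rfl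

lemma ov_continuous (p : ℕ) (v : ZZ) : Continuous (ov p v) := by
  refine continuous_pi fun n => ?_
  unfold ov
  split_ifs
  · exact continuous_const
  · exact continuous_apply n

/-- cylinders form a neighbourhood basis -/
lemma cyl_nhds (y : ZZ) : (nhds y).HasBasis (fun _ : ℕ => True)
    (fun q => {x : ZZ | ∀ n < q, x n = y n}) := by
  constructor
  intro s
  constructor
  · intro hs
    rw [nhds_pi, Filter.mem_pi] at hs
    obtain ⟨I, hI, t, ht, hts⟩ := hs
    obtain ⟨q, hq⟩ := hI.bddAbove
    refine ⟨q + 1, trivial, fun x hx => hts fun i hi => ?_⟩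
    have : x i = y i := hx i (Nat.lt_succ_of_le (hq hi))
    rw [this]
    exact mem_of_mem_nhds (ht i)
  · rintro ⟨q, -, hq⟩
    refine Filter.mem_of_superset ?_ hq
    have : {x : ZZ | ∀ n < q, x n = y n} = ⋂ n ∈ Finset.range q, (fun x : ZZ => x n) ⁻¹' {y n} := by
      ext x; simp
    rw [this, Filter.biInter_finset_mem]
    intro n _
    exact (continuous_apply n).continuousAt.preimage_mem_nhds (by simp)

lemma ov_isOpenMap (p : ℕ) (v : ZZ) : IsOpenMap (ov p v) := by
  rw [isOpenMap_iff_nhds_le]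
  intro y
  intro s hs
  rw [Filter.mem_map] at hs
  obtain ⟨q, -, hq⟩ := (cyl_nhds y).mem_iff.1 hs
  refine (cyl_nhds _).mem_iff.2 ⟨max p q, trivial, fun x hx => ?_⟩
  have h1 : ov p v (ov p y x) = x := by
    funext n
    unfold ov
    split_ifs with hn
    · have := hx n (lt_max_of_lt_left hn)
      rw [this]; simp [ov, hn]
    · rfl
  have h2 : ov p y x ∈ {x : ZZ | ∀ n < q, x n = y n} := by
    intro n hn
    unfold ov
    split_ifs with hnp
    · rfl
    · have := hx n (lt_max_of_lt_right hn)
      rw [this]; simp [ov, hnp]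
  have := hq h2
  rw [mem_preimage, h1] at this
  exact this

lemma ov_finite (p : ℕ) : (range fun v : ZZ => ov p v (fun _ => 0)).Finite := by
  have : (range fun v : ZZ => ov p v (fun _ => 0)) ⊆
      range fun w : (∀ i : Fin p, Fin (2 ^ tp i + 1)) =>
        (fun n => if h : n < p then w ⟨n, h⟩ else 0 : ZZ) := by
    rintro _ ⟨v, rfl⟩
    refine ⟨fun i => v i, ?_⟩
    funext n
    simp only [ov]
    split_ifs <;> rfl
  exact (finite_range _).subset this

lemma ov_rep (p : ℕ) (v y : ZZ) : ov p v y = ov p (ov p v (fun _ => 0)) y :=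
  ov_congr (fun n hn => by simp [ov, hn]) (fun _ _ => rfl)

/-- for properties of `ov p v ·`: finitely many `v` suffice -/
lemma ov_eventually_forall {l : Filter ℕ} (p : ℕ) (P : (ZZ → ZZ) → ℕ → Prop)
    (h : ∀ v, ∀ᶠ q in l, P (ov p v) q) : ∀ᶠ q in l, ∀ v, P (ov p v) q := by
  have h1 : ∀ᶠ q in l, ∀ w ∈ (range fun v : ZZ => ov p v (fun _ => 0)), P (ov p w) q :=
    (Filter.eventually_all_finite (ov_finite p)).2 fun w _ => h w
  filter_upwards [h1] with q hq v
  have := hq _ ⟨v, rfl⟩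
  have e : ov p v = ov p (ov p v (fun _ => 0)) := funext fun y => ov_rep p v y
  rw [e]; exact this

lemma star_residual {C : Set ZZ} (hC : C ∈ residual ZZ) :
    {y : ZZ | ∀ p v, ov p v y ∈ C} ∈ residual ZZ := by
  have h1 : ∀ᶠ y in residual ZZ, ∀ p : ℕ,
      ∀ w ∈ (range fun v : ZZ => ov p v (fun _ => 0)), ov p w y ∈ C := by
    refine eventually_countable_forall.2 fun p => ?_
    refine (Filter.eventually_all_finite (ov_finite p)).2 fun w _ => ?_
    exact tendsto_residual_of_isOpenMap (ov_continuous p w) (ov_isOpenMap p w) hC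
  filter_upwards [h1] with y hy p v
  rw [ov_rep]
  exact hy p _ ⟨v, rfl⟩

lemma tail_eventually {h : ℕ → ℝ} (hs : Summable h) {ε : ℝ} (hε : 0 < ε) :
    ∀ᶠ L in Filter.atTop, ∀ M, ∑ n ∈ Finset.Ico L M, h n ≤ ε := by
  obtain ⟨s, hs⟩ := summable_iff_vanishing_norm.1 hs ε hε
  filter_upwards [Filter.eventually_gt_atTop (s.sup id)] with L hL M
  refine (le_abs_self _).trans (hs _ ?_).le
  rw [Finset.disjoint_left]
  intro n hn hns
  have : n ≤ s.sup id := Finset.le_sup (f := id) hns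
  have := (Finset.mem_Ico.1 hn).1
  omega

abbrev YY : Type := ℕ → Icc (0:ℝ) 1

lemma stage {g : ℝ → ℝ} (h0 : g 0 = 0)
    (hG : Continuous fun p : Icc (0:ℝ) 1 × Icc (0:ℝ) 1 => g |(p.1:ℝ) - p.2|)
    {Θ : ZZ → YY} {C : Set ZZ} (hC : C ∈ residual ZZ) (hΘ : ContinuousOn Θ C)
    {O : ℕ → Set ZZ} (hO : ∀ i, IsOpen (O i)) (hCO : ∀ i, C ⊆ O i)
    (hfin : ∀ p v v' y, EF g (Θ (ov p v y)) (Θ (ov p v' y)))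
    (ε : ℝ) (hε : 0 < ε) (i t p L : ℕ) :
    ∃ (y0 : ZZ) (q L' : ℕ), p < q ∧ L < L' ∧ tp q = t ∧
      ∀ v y : ZZ, (∀ n, p + 1 ≤ n → n < q → y n = y0 n) →
        ov (p+1) v y ∈ O i ∧
        (∀ v', ov (p+1) v y ∈ C → ov (p+1) v' y ∈ C → ∀ M, ∑ n ∈ Finset.Ico L' M,
          g |(Θ (ov (p+1) v y) n : ℝ) - Θ (ov (p+1) v' y) n| ≤ ε) ∧
        (ov (p+1) v y ∈ C → ∑ n ∈ Finset.range L',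
          g |(Θ (ov (p+1) v y) n : ℝ) - Θ (ov (p+1) v y0) n| ≤ ε) := by
  set P := p + 1 with hP
  set S : Set ZZ := {y : ZZ | ∀ p v, ov p v y ∈ C} with hS
  have hSr : S ∈ residual ZZ := star_residual hC
  let A : ℕ → Set ZZ := fun k => {y | y ∈ S ∧ ∀ v v' M, ∑ n ∈ Finset.Ico (L + 1 + k) M,
          g |(Θ (ov P v y) n : ℝ) - Θ (ov P v' y) n| ≤ ε}
  have hSA : S ⊆ ⋃ k, closure (A k) := by
    intro y hy
    have h1 : ∀ᶠ q in Filter.atTop, ∀ v v' M, ∑ n ∈ Finset.Ico q M,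
          g |(Θ (ov P v y) n : ℝ) - Θ (ov P v' y) n| ≤ ε := by
      refine ov_eventually_forall P (fun F q => ∀ v' M, ∑ n ∈ Finset.Ico q M,
          g |(Θ (F y) n : ℝ) - Θ (ov P v' y) n| ≤ ε) fun v => ?_
      refine ov_eventually_forall P (fun F q => ∀ M, ∑ n ∈ Finset.Ico q M,
          g |(Θ (ov P v y) n : ℝ) - Θ (F y) n| ≤ ε) fun v' => ?_
      exact tail_eventually (hfin P v v' y) hε
    obtain ⟨q, hq⟩ := Filter.eventually_atTop.1 h1
    exact mem_iUnion.2 ⟨q, subset_closure ⟨hy, hq _ (by omega)⟩⟩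
  obtain ⟨D, hDS, hDG, hDd⟩ := mem_residual.1 hSr
  have hdense := hDG.dense_iUnion_interior_of_closed hDd
    (f := fun k => closure (A k)) (fun k => isClosed_closure) (hDS.trans hSA)
  obtain ⟨z, hz⟩ := hdense.nonempty
  obtain ⟨k, hk⟩ := mem_iUnion.1 hz
  obtain ⟨y0, hy0i, hy0S⟩ := (dense_of_mem_residual hSr).inter_open_nonempty _ isOpen_interior ⟨z, hk⟩
  set L' := L + 1 + k with hL'
  -- property (1)
  have c1 : ∀ᶠ q in Filter.atTop, ∀ v v' y : ZZ, (∀ n, P ≤ n → n < q → y n = y0 n) →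
      ov P v y ∈ C → ov P v' y ∈ C → ∀ M, ∑ n ∈ Finset.Ico L' M,
          g |(Θ (ov P v y) n : ℝ) - Θ (ov P v' y) n| ≤ ε := by
    obtain ⟨q1, -, hq1⟩ := (cyl_nhds y0).mem_iff.1 (isOpen_interior.mem_nhds hy0i)
    filter_upwards [Filter.eventually_ge_atTop q1] with q hq v v' y hy hv hv' M
    set y1 := ov P y0 y with hy1
    have e : ∀ v, ov P v y = ov P v y1 := fun v =>
      ov_congr (fun _ _ => rfl) (fun n hn => by simp [hy1, ov, not_lt.2 hn])
    rw [e v, e v'] at *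
    have hcl : y1 ∈ closure (A k) := by
      apply interior_subset
      apply hq1
      intro n hn
      by_cases hnP : n < P
      · simp [hy1, ov, hnP]
      · simp only [hy1, ov, hnP, if_false]
        exact hy n (not_lt.1 hnP) (by omega)
    have hct : ∀ v, ov P v y1 ∈ C →
        ContinuousWithinAt (fun y => Θ (ov P v y)) (A k) y1 := by
      intro v hv
      exact ContinuousWithinAt.comp (t := C) (hΘ _ hv) (ov_continuous P v).continuousWithinAt
        (fun y hy => hy.1 P v)
    have hcont : ContinuousWithinAt (fun y => ∑ n ∈ Finset.Ico L' M,
          g |(Θ (ov P v y) n : ℝ) - Θ (ov P v' y) n|) (A k) y1 := by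
      refine tendsto_finsetSum _ fun n _ => ?_
      have h1 := (tendsto_pi_nhds.1 (hct v hv) n)
      have h2 := (tendsto_pi_nhds.1 (hct v' hv') n)
      exact (hG.tendsto _).comp (h1.prodMk_nhds h2)
    haveI := mem_closure_iff_nhdsWithin_neBot.1 hcl
    refine le_of_tendsto hcont ?_
    filter_upwards [self_mem_nhdsWithin] with y hy
    exact hy.2 v v' M
  -- properties (2) and (3)
  have c3 : ∀ᶠ q in Filter.atTop, ∀ v, ∀ y : ZZ, (∀ n, P ≤ n → n < q → y n = y0 n) →
      ov P v y ∈ O i := by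
    refine ov_eventually_forall P (fun F q => ∀ y : ZZ, (∀ n, P ≤ n → n < q → y n = y0 n) →
      F y ∈ O i) fun v => ?_
    obtain ⟨q1, -, hq1⟩ := (cyl_nhds (ov P v y0)).mem_iff.1
      ((hO i).mem_nhds (hCO i (hy0S P v)))
    filter_upwards [Filter.eventually_ge_atTop q1] with q hq y hy
    apply hq1
    intro n hn
    by_cases hnP : n < P
    · simp [ov, hnP]
    · simp only [ov, hnP, if_false]
      exact hy n (not_lt.1 hnP) (by omega)
  have c2 : ∀ᶠ q in Filter.atTop, ∀ v, ∀ y : ZZ, (∀ n, P ≤ n → n < q → y n = y0 n) →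
      ov P v y ∈ C → ∑ n ∈ Finset.range L',
          g |(Θ (ov P v y) n : ℝ) - Θ (ov P v y0) n| ≤ ε := by
    refine ov_eventually_forall P (fun F q => ∀ y : ZZ, (∀ n, P ≤ n → n < q → y n = y0 n) →
      F y ∈ C → ∑ n ∈ Finset.range L', g |(Θ (F y) n : ℝ) - Θ (F y0) n| ≤ ε) fun v => ?_
    have hcont : Filter.Tendsto (fun x => ∑ n ∈ Finset.range L',
          g |(Θ x n : ℝ) - Θ (ov P v y0) n|) (nhdsWithin (ov P v y0) C)
          (nhds (∑ n ∈ Finset.range L', g |(Θ (ov P v y0) n : ℝ) - Θ (ov P v y0) n|)) := by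
      refine tendsto_finsetSum _ fun n _ => ?_
      have h1 := (tendsto_pi_nhds.1 (hΘ _ (hy0S P v)) n)
      exact (hG.tendsto _).comp (h1.prodMk_nhds tendsto_const_nhds)
    have hz : (∑ n ∈ Finset.range L', g |(Θ (ov P v y0) n : ℝ) - Θ (ov P v y0) n|) < ε := by
      simpa [h0] using hε
    obtain ⟨q1, -, hq1⟩ := ((cyl_nhds (ov P v y0)).inf_principal C).mem_iff.1
      (hcont.eventually_lt_const hz)
    filter_upwards [Filter.eventually_ge_atTop q1] with q hq y hy hyC
    refine le_of_lt (hq1 ⟨?_, hyC⟩)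
    intro n hn
    by_cases hnP : n < P
    · simp [ov, hnP]
    · simp only [ov, hnP, if_false]
      exact hy n (not_lt.1 hnP) (by omega)
  obtain ⟨q0, hq0⟩ := Filter.eventually_atTop.1 (c1.and (c2.and c3))
  have hle : max q0 P ≤ Nat.pair t (max q0 P) := Nat.right_le_pair _ _
  refine ⟨y0, Nat.pair t (max q0 P), L', by omega, by omega, by simp [tp], fun v y hy => ?_⟩
  obtain ⟨a1, a2, a3⟩ := hq0 (Nat.pair t (max q0 P)) (by omega)
  exact ⟨a3 v y hy, fun v' hv hv' M => a1 v v' y hy hv hv' M, a2 v y hy⟩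

/-! ### Additive form of a reduction -/

def idx (s : ℕ → ℕ) (n : ℕ) : ℕ := Nat.findGreatest (fun i => s i ≤ n) n

lemma idx_spec {s : ℕ → ℕ} (hs : StrictMono s) (h0 : s 0 = 0) (n : ℕ) :
    s (idx s n) ≤ n ∧ n < s (idx s n + 1) := by
  constructor
  · exact Nat.findGreatest_spec (P := fun i => s i ≤ n) (Nat.zero_le n) (by simp [h0])
  · by_contra hcon
    push Not at hcon
    have h1 : idx s n + 1 ≤ n := (hs.id_le _).trans hcon
    have := Nat.le_findGreatest (P := fun i => s i ≤ n) h1 hcon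
    unfold idx at this
    omega

lemma idx_eq {s : ℕ → ℕ} (hs : StrictMono s) (h0 : s 0 = 0) {n i : ℕ} (h1 : s i ≤ n)
    (h2 : n < s (i+1)) : idx s n = i := by
  obtain ⟨h3, h4⟩ := idx_spec hs h0 n
  have a1 := hs.lt_iff_lt.1 (h1.trans_lt h4)
  have a2 := hs.lt_iff_lt.1 (h3.trans_lt h2)
  omega

lemma summable_blocks {h : ℕ → ℝ} (hnn : ∀ n, 0 ≤ h n) {L : ℕ → ℕ} (hL : StrictMono L)
    (hL0 : L 0 = 0) :
    Summable h ↔ Summable fun i => ∑ n ∈ Finset.Ico (L i) (L (i+1)), h n := by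
  have key : ∀ m, ∑ i ∈ Finset.range m, ∑ n ∈ Finset.Ico (L i) (L (i+1)), h n
      = ∑ n ∈ Finset.range (L m), h n := by
    intro m
    induction m with
    | zero => simp [hL0]
    | succ m ih =>
      rw [Finset.sum_range_succ, ih, Finset.range_eq_Ico, Finset.range_eq_Ico,
        Finset.sum_Ico_consecutive _ (Nat.zero_le _) (hL.monotone (Nat.le_succ m))]
  constructor
  · intro hs
    refine summable_of_sum_range_le (c := ∑' n, h n)
      (fun i => Finset.sum_nonneg fun n _ => hnn n) fun m => ?_
    rw [key]
    exact hs.sum_le_tsum _ (fun n _ => hnn n)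
  · intro hs
    refine summable_of_sum_range_le (c := ∑' i, ∑ n ∈ Finset.Ico (L i) (L (i+1)), h n) hnn
      fun m => ?_
    refine (Finset.sum_le_sum_of_subset_of_nonneg (Finset.range_mono (hL.id_le m))
      (fun n _ _ => hnn n)).trans ?_
    rw [← key]
    exact hs.sum_le_tsum _ (fun i _ => Finset.sum_nonneg fun n _ => hnn n)

noncomputable def eZ (z : ZZ) : YY := fun n => ⟨((z n : ℕ) : ℝ) / 2 ^ tp n, by
  constructor
  · positivity
  · rw [div_le_one (by positivity)]
    have : (z n : ℕ) ≤ 2 ^ tp n := Nat.lt_succ_iff.1 (z n).2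
    exact_mod_cast this⟩

lemma eZ_measurable : Measurable eZ := by
  have : Continuous eZ := by
    refine continuous_pi fun n => ?_
    exact (continuous_of_discreteTopology (f := fun k : Fin (2 ^ tp n + 1) =>
      (⟨((k : ℕ) : ℝ) / 2 ^ tp n, by
        constructor
        · positivity
        · rw [div_le_one (by positivity)]
          have : (k : ℕ) ≤ 2 ^ tp n := Nat.lt_succ_iff.1 k.2
          exact_mod_cast this⟩ : Icc (0:ℝ) 1))).comp (continuous_apply n)
  exact this.measurable

lemma additive {f g : ℝ → ℝ} (hf0 : f 0 = 0) (h0 : g 0 = 0)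
    (hnn : ∀ t ∈ Icc (0:ℝ) 1, 0 ≤ g t) (hgc : ContinuousOn g (Icc 0 1))
    {K : ℝ} (hK1 : 1 ≤ K) (hK : PTri K g) (hred : BorelReducible (EF f) (EF g)) :
    ∃ (L : ℕ → ℕ) (T : ℕ → ℕ → ℕ → Icc (0:ℝ) 1), StrictMono L ∧ L 0 = 0 ∧
      ∀ J J' : ℕ → ℕ, (∀ i, J i ≤ 2 ^ tp i) → (∀ i, J' i ≤ 2 ^ tp i) →
        ((Summable fun i => f |(J i : ℝ) / 2 ^ tp i - (J' i : ℝ) / 2 ^ tp i|) ↔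
        Summable fun i => ∑ n ∈ Finset.Ico (L i) (L (i+1)),
          g |(T i (J i) n : ℝ) - T i (J' i) n|) := by
  obtain ⟨θ, hθ, hθr⟩ := hred
  set Θ : ZZ → YY := fun z => θ (eZ z) with hΘdef
  have hΘm : Measurable Θ := hθ.comp eZ_measurable
  have heq := EF_equiv h0 hnn hK
  have hG : Continuous fun p : Icc (0:ℝ) 1 × Icc (0:ℝ) 1 => g |(p.1:ℝ) - p.2| :=
    hgc.comp_continuous (by fun_prop) (fun p => abs_sub_mem p.1.2 p.2.2)
  obtain ⟨C0, hC0, hcont0⟩ := exists_residual_continuousOn Θ hΘm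
  obtain ⟨C, hCC0, hCG, hCd⟩ := mem_residual.1 hC0
  have hCr : C ∈ residual ZZ := residual_of_dense_Gδ hCG hCd
  have hcont := hcont0.mono hCC0
  obtain ⟨O, hO, hCO⟩ := isGδ_iff_eq_iInter_nat.1 hCG
  have hfin : ∀ p v v' y, EF g (Θ (ov p v y)) (Θ (ov p v' y)) := by
    intro p v v' y
    rw [hΘdef, ← hθr]
    refine summable_of_ne_finset_zero (s := Finset.range p) fun n hn => ?_
    have hn' : ¬ n < p := by simpa using hn
    simp [eZ, ov, hn', hf0]
  have hst := fun i p L => stage h0 hG hCr hcont hO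
    (fun i => by rw [hCO]; exact iInter_subset O i) hfin ((1/2:ℝ)^i) (by positivity) i (tp (i+1)) p L
  choose Y0 Q LL hQ hLL htp hst using hst
  let st : ℕ → ℕ × ℕ := fun i => Nat.rec (0, 0) (fun i s => (Q i s.1 s.2, LL i s.1 s.2)) i
  let p : ℕ → ℕ := fun i => (st i).1
  let L : ℕ → ℕ := fun i => (st i).2
  let y0 : ℕ → ZZ := fun i => Y0 i (p i) (L i)
  have hpS : ∀ i, p (i+1) = Q i (p i) (L i) := fun i => rfl
  have hLS : ∀ i, L (i+1) = LL i (p i) (L i) := fun i => rfl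
  have hp0 : p 0 = 0 := rfl
  have hL0 : L 0 = 0 := rfl
  have hp : StrictMono p := strictMono_nat_of_lt_succ fun i => by rw [hpS]; exact hQ _ _ _
  have hL : StrictMono L := strictMono_nat_of_lt_succ fun i => by rw [hLS]; exact hLL _ _ _
  have hptp : ∀ i, tp (p i) = tp i := by
    intro i
    cases i with
    | zero => rfl
    | succ i => rw [hpS]; exact htp _ _ _
  replace hst : ∀ i, ∀ v y : ZZ, (∀ n, p i + 1 ≤ n → n < p (i+1) → y n = y0 i n) →
        ov (p i+1) v y ∈ O i ∧
        (∀ v', ov (p i+1) v y ∈ C → ov (p i+1) v' y ∈ C → ∀ M, ∑ n ∈ Finset.Ico (L (i+1)) M,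
          g |(Θ (ov (p i+1) v y) n : ℝ) - Θ (ov (p i+1) v' y) n| ≤ (1/2:ℝ)^i) ∧
        (ov (p i+1) v y ∈ C → ∑ n ∈ Finset.range (L (i+1)),
          g |(Θ (ov (p i+1) v y) n : ℝ) - Θ (ov (p i+1) v (y0 i)) n| ≤ (1/2:ℝ)^i) :=
    fun i => hst i (p i) (L i)
  let X : (ℕ → ℕ) → ZZ := fun J n =>
    if n = p (idx p n) then Fin.ofNat _ (J (idx p n)) else y0 (idx p n) n
  have hXfree : ∀ J i, X J (p i) = Fin.ofNat _ (J i) := by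
    intro J i
    have : idx p (p i) = i := idx_eq hp hp0 le_rfl (hp (Nat.lt_succ_self i))
    simp only [X, this, if_true]
  have hXfix : ∀ J i n, p i + 1 ≤ n → n < p (i+1) → X J n = y0 i n := by
    intro J i n h1 h2
    have : idx p n = i := idx_eq hp hp0 (by omega) h2
    have h3 : n ≠ p i := by omega
    simp only [X, this, h3, if_false]
  have hXcongr : ∀ J J' n, J (idx p n) = J' (idx p n) → X J n = X J' n := by
    intro J J' n h
    simp only [X, h]
  have hXC : ∀ J, X J ∈ C := by
    intro J
    rw [hCO]
    refine mem_iInter.2 fun i => ?_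
    have := (hst i (X J) (X J) (hXfix J i)).1
    rwa [ov_self] at this
  let T : ℕ → ℕ → ℕ → Icc (0:ℝ) 1 := fun i j => Θ (ov (p i + 1) (X (Pi.single i j)) (y0 i))
  refine ⟨L, T, hL, hL0, fun J J' hJ hJ' => ?_⟩
  -- the error estimate
  have herr : ∀ J : ℕ → ℕ, ∀ i, ∑ n ∈ Finset.Ico (L (i+1)) (L (i+2)),
      g |(Θ (X J) n : ℝ) - T (i+1) (J (i+1)) n| ≤ K * ((1/2:ℝ)^i + (1/2:ℝ)^(i+1)) := by
    intro J i
    let J1 : ℕ → ℕ := fun m => if m < i + 1 then 0 else J m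
    have e1 : ov (p i + 1) (X J1) (X J) = X J1 := by
      conv_rhs => rw [← ov_self (p i + 1) (X J1)]
      refine ov_congr (fun _ _ => rfl) fun n hn => ?_
      have hsp := idx_spec hp hp0 n
      by_cases hni : i + 1 ≤ idx p n
      · refine hXcongr _ _ _ ?_
        simp only [J1, if_neg (not_lt.2 hni)]
      · have : idx p n = i := by
          have : i ≤ idx p n := by
            have h9 : p i < p (idx p n + 1) := lt_of_lt_of_le (Nat.lt_of_succ_le hn) hsp.2.le
            have h10 : i < idx p n + 1 := hp.lt_iff_lt.1 h9
            omega
          omega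
        rw [this] at hsp
        rw [hXfix J i n hn hsp.2, hXfix J1 i n hn hsp.2]
    have e2 : ov (p (i+1) + 1) (X J1) (y0 (i+1)) =
        ov (p (i+1) + 1) (X (Pi.single (i+1) (J (i+1)))) (y0 (i+1)) := by
      refine ov_congr (fun n hn => ?_) (fun _ _ => rfl)
      refine hXcongr _ _ _ ?_
      have hsp := idx_spec hp hp0 n
      have h1 : idx p n < i + 2 := hp.lt_iff_lt.1 (by
        have := hp (Nat.lt_succ_self (i+1))
        show p (idx p n) < p (i+2)
        have : p (i+1) < p (i+2) := this
        omega)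
      by_cases h2 : idx p n = i + 1
      · simp [h2, J1]
      · have : idx p n < i + 1 := by omega
        simp only [J1, if_pos this, Pi.single_apply, h2, if_false]
    have a1 := (hst i (X J) (X J) (hXfix J i)).2.1 (X J1)
    rw [e1, ov_self] at a1
    have a2 := a1 (hXC J) (hXC J1) (L (i+2))
    have a3 := (hst (i+1) (X J1) (X J1) (hXfix J1 (i+1))).2.2
    rw [ov_self, e2] at a3
    have a4 := a3 (hXC J1)
    have a5 : ∑ n ∈ Finset.Ico (L (i+1)) (L (i+2)),
        g |(Θ (X J1) n : ℝ) - T (i+1) (J (i+1)) n| ≤ (1/2:ℝ)^(i+1) := by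
      refine (Finset.sum_le_sum_of_subset_of_nonneg (fun n hn => ?_) (fun n _ _ => ?_)).trans a4
      · exact Finset.mem_range.2 (Finset.mem_Ico.1 hn).2
      · exact hnn _ (abs_sub_mem (Subtype.prop _) (Subtype.prop _))
    calc _ ≤ ∑ n ∈ Finset.Ico (L (i+1)) (L (i+2)), K * (g |(Θ (X J) n : ℝ) - Θ (X J1) n|
          + g |(Θ (X J1) n : ℝ) - T (i+1) (J (i+1)) n|) :=
          Finset.sum_le_sum fun n _ => hK _ (Subtype.prop _) _ (Subtype.prop _) _ (Subtype.prop _)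
      _ = K * (∑ n ∈ Finset.Ico (L (i+1)) (L (i+2)), g |(Θ (X J) n : ℝ) - Θ (X J1) n| +
          ∑ n ∈ Finset.Ico (L (i+1)) (L (i+2)), g |(Θ (X J1) n : ℝ) - T (i+1) (J (i+1)) n|) := by
          rw [← Finset.mul_sum, Finset.sum_add_distrib]
      _ ≤ _ := by gcongr
  let TT : (ℕ → ℕ) → YY := fun J n => T (idx L n) (J (idx L n)) n
  have hTT : ∀ J i n, n ∈ Finset.Ico (L i) (L (i+1)) → TT J n = T i (J i) n := by
    intro J i n hn
    have := idx_eq hL hL0 (Finset.mem_Ico.1 hn).1 (Finset.mem_Ico.1 hn).2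
    simp only [TT, this]
  have hclose : ∀ J, EF g (Θ (X J)) (TT J) := by
    intro J
    refine (summable_blocks (fun n => hnn _ (abs_sub_mem (Subtype.prop _) (Subtype.prop _)))
      hL hL0).2 ?_
    rw [← summable_nat_add_iff 1]
    have hsum : Summable fun i : ℕ => K * ((1/2:ℝ)^i + (1/2:ℝ)^(i+1)) := by
      refine Summable.mul_left _ (Summable.add summable_geometric_two ?_)
      exact (summable_nat_add_iff 1).2 summable_geometric_two
    refine Summable.of_nonneg_of_le (fun i => Finset.sum_nonneg fun n _ => hnn _
      (abs_sub_mem (Subtype.prop _) (Subtype.prop _))) (fun i => ?_) hsum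
    refine le_trans (le_of_eq ?_) (herr J i)
    refine Finset.sum_congr rfl fun n hn => ?_
    rw [hTT J (i+1) n hn]
  have hfs : (Summable fun i => f |(J i : ℝ) / 2 ^ tp i - (J' i : ℝ) / 2 ^ tp i|) ↔
      EF f (eZ (X J)) (eZ (X J')) := by
    unfold EF
    rw [← hp.injective.summable_iff (f := fun n => f |(eZ (X J) n : ℝ) - (eZ (X J') n : ℝ)|)]
    · have hv : ∀ J : ℕ → ℕ, (∀ i, J i ≤ 2 ^ tp i) → ∀ i,
          (eZ (X J) (p i) : ℝ) = (J i : ℝ) / 2 ^ tp i := by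
        intro J hJ i
        have h1 : ((X J (p i) : ℕ)) = J i := by
          rw [hXfree]
          show J i % (2 ^ tp (p i) + 1) = J i
          rw [hptp]
          exact Nat.mod_eq_of_lt (Nat.lt_succ_of_le (hJ i))
        simp only [eZ, h1, hptp]
      simp only [Function.comp_def, hv J hJ, hv J' hJ']
    · intro n hn
      have hne : n ≠ p (idx p n) := fun h => hn ⟨_, h.symm⟩
      have : X J n = X J' n := by simp only [X, hne, if_false]
      simp [eZ, this, hf0]
  rw [hfs, hθr]
  have h1 : EF g (Θ (X J)) (Θ (X J')) ↔ EF g (TT J) (TT J') :=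
    ⟨fun h => heq.trans (heq.symm (hclose J)) (heq.trans h (hclose J')),
      fun h => heq.trans (hclose J) (heq.trans h (heq.symm (hclose J')))⟩
  rw [show EF g (θ (eZ (X J))) (θ (eZ (X J'))) ↔ _ from h1]
  unfold EF
  rw [summable_blocks (fun n => hnn _ (abs_sub_mem (Subtype.prop _) (Subtype.prop _))) hL hL0]
  refine iff_of_eq (congrArg Summable (funext fun i => Finset.sum_congr rfl fun n hn => ?_))
  rw [hTT J i n hn, hTT J' i n hn]

/-! ### Uniform finite embeddings -/

lemma select (P : ℕ → ℕ → Prop) (hP : ∀ s, {i | P s i}.Infinite) (q : ℕ → ℕ) :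
    ∃ F : ℕ → Finset ℕ, (∀ s, (F s).card = q s) ∧ (∀ s, ∀ i ∈ F s, P s i) ∧
      (∀ s s', ∀ i, i ∈ F s → i ∈ F s' → s = s') ∧ ∀ s, ∀ i ∈ F s, s ≤ i := by
  have h1 : ∀ s b : ℕ, ∃ F : Finset ℕ, F.card = q s ∧ ∀ i ∈ F, P s i ∧ b ≤ i := by
    intro s b
    have hinf : ({i | P s i} \ {i | i < b}).Infinite := (hP s).sdiff (finite_lt_nat b)
    obtain ⟨F, hF, hc⟩ := hinf.exists_subset_card_eq (q s)
    exact ⟨F, hc, fun i hi => ⟨(hF hi).1, not_lt.1 (hF hi).2⟩⟩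
  choose G hGc hG using h1
  let b : ℕ → ℕ := fun s => Nat.rec 0 (fun s b => max (b + 1) ((G s b).sup id + 1)) s
  have hbS : ∀ s, b (s+1) = max (b s + 1) ((G s (b s)).sup id + 1) := fun s => rfl
  have hb : StrictMono b := strictMono_nat_of_lt_succ fun s => by rw [hbS]; omega
  have hub : ∀ s, ∀ i ∈ G s (b s), i < b (s+1) := by
    intro s i hi
    have : i ≤ (G s (b s)).sup id := Finset.le_sup (f := id) hi
    rw [hbS]; omega
  refine ⟨fun s => G s (b s), fun s => hGc _ _, fun s i hi => (hG _ _ i hi).1, ?_,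
    fun s i hi => (hb.id_le s).trans (hG _ _ i hi).2⟩
  intro s s' i hi hi'
  have a1 := hub s i hi
  have a2 := hub s' i hi'
  have a3 := (hG _ _ i hi).2
  have a4 := (hG _ _ i hi').2
  have h1 : b s' < b (s+1) := a4.trans_lt a1
  have h2 : b s < b (s'+1) := a3.trans_lt a2
  have h3 : s' < s + 1 := hb.lt_iff_lt.1 h1
  have h4 : s < s' + 1 := hb.lt_iff_lt.1 h2
  omega

lemma summable_of_select {h : ℕ → ℝ} (hnn : ∀ i, 0 ≤ h i) {F : ℕ → Finset ℕ}
    (hsupp : ∀ i, h i ≠ 0 → ∃ s, i ∈ F s) (hge : ∀ s, ∀ i ∈ F s, s ≤ i) {b : ℕ → ℝ}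
    (hb : Summable b) (hb0 : ∀ s, 0 ≤ b s) (hle : ∀ s, ∑ i ∈ F s, h i ≤ b s) : Summable h := by
  refine summable_of_sum_range_le (c := ∑' s, b s) hnn fun m => ?_
  calc ∑ i ∈ Finset.range m, h i
      ≤ ∑ i ∈ Finset.range m, ∑ s ∈ Finset.range m, if i ∈ F s then h i else 0 := by
        refine Finset.sum_le_sum fun i hi => ?_
        by_cases h0 : h i = 0
        · rw [h0]; exact Finset.sum_nonneg fun s _ => by split_ifs <;> simp
        · obtain ⟨s, hs⟩ := hsupp i h0
          have hsm : s ∈ Finset.range m :=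
            Finset.mem_range.2 ((hge s i hs).trans_lt (Finset.mem_range.1 hi))
          have := Finset.single_le_sum (f := fun s => if i ∈ F s then h i else 0)
            (fun s _ => by
              show (0:ℝ) ≤ if i ∈ F s then h i else 0
              split_ifs
              · exact hnn i
              · exact le_rfl) hsm
          simpa [hs] using this
    _ = ∑ s ∈ Finset.range m, ∑ i ∈ Finset.range m, if i ∈ F s then h i else 0 :=
        Finset.sum_comm
    _ ≤ ∑ s ∈ Finset.range m, b s := by
        refine Finset.sum_le_sum fun s _ => le_trans ?_ (hle s)
        rw [← Finset.sum_filter]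
        refine Finset.sum_le_sum_of_subset_of_nonneg (fun i hi => (Finset.mem_filter.1 hi).2)
          fun i _ _ => hnn i
    _ ≤ _ := hb.sum_le_tsum _ fun s _ => hb0 s

lemma not_summable_of_select {h : ℕ → ℝ} {F : ℕ → Finset ℕ}
    (hge : ∀ s, ∀ i ∈ F s, s ≤ i) (hle : ∀ s, 1 ≤ ∑ i ∈ F s, h i) : ¬ Summable h := by
  intro hs
  obtain ⟨t, ht⟩ := summable_iff_vanishing_norm.1 hs 1 one_pos
  have h1 := ht (F (t.sup id + 1)) (by
    rw [Finset.disjoint_left]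
    intro i hi hit
    have : i ≤ t.sup id := Finset.le_sup (f := id) hit
    have := hge _ i hi
    omega)
  have h2 := hle (t.sup id + 1)
  rw [Real.norm_eq_abs] at h1
  have := le_abs_self (∑ i ∈ F (t.sup id + 1), h i)
  linarith

/-- the selection of pairs along a selector of indices -/
lemma pick {F : ℕ → Finset ℕ} (hdis : ∀ s s', ∀ i, i ∈ F s → i ∈ F s' → s = s')
    (t j : ℕ → ℕ) (hj : ∀ s, j s ≤ 2 ^ t s) (ht : ∀ s, ∀ i ∈ F s, tp i = t s) :
    ∃ J : ℕ → ℕ, (∀ i, J i ≤ 2 ^ tp i) ∧ (∀ s, ∀ i ∈ F s, J i = j s) ∧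
      ∀ i, (∀ s, i ∉ F s) → J i = 0 := by
  classical
  refine ⟨fun i => if h : ∃ s, i ∈ F s then j h.choose else 0, fun i => ?_, fun s i hi => ?_,
    fun i hi => ?_⟩
  · dsimp only
    split_ifs with h
    · rw [ht _ i h.choose_spec]; exact hj _
    · exact Nat.zero_le _
  · have h : ∃ s, i ∈ F s := ⟨s, hi⟩
    simp only [h, dif_pos]
    rw [hdis _ _ i h.choose_spec hi]
  · have h : ¬ ∃ s, i ∈ F s := fun ⟨s, hs⟩ => hi s hs
    simp only [h, dif_neg, not_false_eq_true]

lemma ceil_bound {b v : ℝ} (hb : 0 < b) (hv : 0 < v) :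
    b ≤ (⌈b / v⌉₊ : ℝ) * v ∧ (⌈b / v⌉₊ : ℝ) * v ≤ b + v := by
  constructor
  · rw [← div_le_iff₀ hv]; exact Nat.le_ceil _
  · have := (Nat.ceil_lt_add_one (div_nonneg hb.le hv.le)).le
    calc (⌈b / v⌉₊ : ℝ) * v ≤ (b / v + 1) * v := by gcongr
      _ = b + v := by field_simp

lemma grid_mem {t j j' : ℕ} (hj : j ≤ 2 ^ t) (hj' : j' ≤ 2 ^ t) :
    |(j:ℝ) / 2 ^ t - (j':ℝ) / 2 ^ t| ∈ Icc (0:ℝ) 1 := by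
  have h : ∀ j : ℕ, j ≤ 2 ^ t → (j:ℝ) / 2 ^ t ∈ Icc (0:ℝ) 1 := by
    intro j hj
    refine ⟨by positivity, ?_⟩
    rw [div_le_one (by positivity)]
    exact_mod_cast hj
  exact abs_sub_mem (h j hj) (h j' hj')

section unif
variable {f : ℝ → ℝ} {D : ℕ → ℕ → ℕ → ℝ}

lemma unif_lower (hf0 : f 0 = 0) (hfpos : ∀ t ∈ Ioc (0:ℝ) 1, 0 < f t)
    (hDnn : ∀ i j j', 0 ≤ D i j j') (hD0 : ∀ i j, D i j j = 0)
    (hD : ∀ J J' : ℕ → ℕ, (∀ i, J i ≤ 2 ^ tp i) → (∀ i, J' i ≤ 2 ^ tp i) →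
        ((Summable fun i => f |(J i : ℝ) / 2 ^ tp i - (J' i : ℝ) / 2 ^ tp i|) ↔
        Summable fun i => D i (J i) (J' i))) :
    ∃ s : ℕ, ∀ t j j' : ℕ, j ≤ 2 ^ t → j' ≤ 2 ^ t → f |(j : ℝ) / 2 ^ t - (j' : ℝ) / 2 ^ t| ≤ 1 →
      {i | tp i = t ∧ 4 ^ s * D i j j' < f |(j : ℝ) / 2 ^ t - (j' : ℝ) / 2 ^ t|}.Finite := by
  by_contra hcon
  push Not at hcon
  choose t j j' hj hj' hf1 hinf using hcon
  set v : ℕ → ℝ := fun s => f |(j s : ℝ) / 2 ^ t s - (j' s : ℝ) / 2 ^ t s| with hv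
  have hvpos : ∀ s, 0 < v s := by
    intro s
    obtain ⟨i, hi⟩ := (show ({i | tp i = t s ∧ 4 ^ s * D i (j s) (j' s) < v s} : Set ℕ).Infinite
      from hinf s).nonempty
    exact lt_of_le_of_lt (mul_nonneg (by positivity) (hDnn _ _ _)) hi.2
  obtain ⟨F, hFc, hFP, hdis, hge⟩ := select (fun s i => tp i = t s ∧ 4 ^ s * D i (j s) (j' s) < v s)
    (fun s => hinf s) (fun s => ⌈1 / v s⌉₊)
  obtain ⟨J, hJ, hJF, hJ0⟩ := pick hdis t j hj (fun s i hi => (hFP s i hi).1)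
  obtain ⟨J', hJ', hJF', hJ0'⟩ := pick hdis t j' hj' (fun s i hi => (hFP s i hi).1)
  have hiff := hD J J' hJ hJ'
  refine not_summable_of_select (F := F) hge (fun s => ?_) (hiff.2 ?_)
  · have : ∀ i ∈ F s, f |(J i : ℝ) / 2 ^ tp i - (J' i : ℝ) / 2 ^ tp i| = v s := by
      intro i hi
      rw [hJF s i hi, hJF' s i hi, (hFP s i hi).1]
    rw [Finset.sum_congr rfl this, Finset.sum_const, hFc, nsmul_eq_mul]
    exact (ceil_bound one_pos (hvpos s)).1
  · refine summable_of_select (F := F) (b := fun s => 2 * (1/2:ℝ)^s) (fun i => hDnn _ _ _)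
      (fun i hi => ?_) hge (summable_geometric_two.mul_left 2) (fun s => by positivity) fun s => ?_
    · by_contra hno
      push Not at hno
      apply hi
      rw [hJ0 i hno, hJ0' i hno, hD0]
    · have : ∀ i ∈ F s, D i (J i) (J' i) ≤ (1/4:ℝ)^s * v s := by
        intro i hi
        rw [hJF s i hi, hJF' s i hi]
        have := (hFP s i hi).2.le
        have h4 : (1/4:ℝ)^s * 4 ^ s = 1 := by rw [← mul_pow]; norm_num
        have h5 : (0:ℝ) < (1/4:ℝ)^s := by positivity
        calc D i (j s) (j' s) = ((1/4:ℝ)^s * 4 ^ s) * D i (j s) (j' s) := by rw [h4, one_mul]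
          _ = (1/4:ℝ)^s * (4 ^ s * D i (j s) (j' s)) := by ring
          _ ≤ (1/4:ℝ)^s * v s := mul_le_mul_of_nonneg_left this h5.le
      refine (Finset.sum_le_sum this).trans ?_
      rw [Finset.sum_const, hFc, nsmul_eq_mul]
      have h1 := (ceil_bound one_pos (hvpos s)).2
      have h2 : (1/4:ℝ)^s ≤ (1/2:ℝ)^s := pow_le_pow_left₀ (by norm_num) (by norm_num) s
      have h3 : v s ≤ 1 := hf1 s
      have h5 : (0:ℝ) < (1/4:ℝ)^s := by positivity
      calc (⌈1 / v s⌉₊ : ℝ) * ((1/4:ℝ)^s * v s) = (1/4:ℝ)^s * (⌈1 / v s⌉₊ * v s) := by ring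
        _ ≤ (1/4:ℝ)^s * 2 := by gcongr; linarith
        _ ≤ 2 * (1/2:ℝ)^s := by linarith

lemma unif_upper (hf0 : f 0 = 0) (hfpos : ∀ t ∈ Ioc (0:ℝ) 1, 0 < f t)
    (hDnn : ∀ i j j', 0 ≤ D i j j') (hD0 : ∀ i j, D i j j = 0)
    (hD : ∀ J J' : ℕ → ℕ, (∀ i, J i ≤ 2 ^ tp i) → (∀ i, J' i ≤ 2 ^ tp i) →
        ((Summable fun i => f |(J i : ℝ) / 2 ^ tp i - (J' i : ℝ) / 2 ^ tp i|) ↔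
        Summable fun i => D i (J i) (J' i))) :
    ∃ s : ℕ, ∀ t j j' : ℕ, j ≤ 2 ^ t → j' ≤ 2 ^ t →
      f |(j : ℝ) / 2 ^ t - (j' : ℝ) / 2 ^ t| ≤ (1/4:ℝ)^s →
      {i | tp i = t ∧ 4 ^ s * f |(j : ℝ) / 2 ^ t - (j' : ℝ) / 2 ^ t| < D i j j'}.Finite := by
  by_contra hcon
  push Not at hcon
  choose t j j' hj hj' hf1 hinf using hcon
  set v : ℕ → ℝ := fun s => f |(j s : ℝ) / 2 ^ t s - (j' s : ℝ) / 2 ^ t s| with hv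
  have hfnn : ∀ x ∈ Icc (0:ℝ) 1, 0 ≤ f x := by
    intro x hx
    rcases hx.1.eq_or_lt with h | h
    · rw [← h, hf0]
    · exact (hfpos x ⟨h, hx.2⟩).le
  have hvpos : ∀ s, 0 < v s := by
    intro s
    have hm := grid_mem (hj s) (hj' s)
    refine hfpos _ ⟨?_, hm.2⟩
    refine lt_of_le_of_ne hm.1 fun h => ?_
    have h1 := abs_eq_zero.1 h.symm
    have h2 : (j s : ℝ) = j' s := by
      have h3 : (0:ℝ) < 2 ^ t s := by positivity
      field_simp at h1
      linarith
    have h4 : j s = j' s := by exact_mod_cast h2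
    obtain ⟨i, hi⟩ := (show ({i | tp i = t s ∧ 4 ^ s * v s < D i (j s) (j' s)} : Set ℕ).Infinite
      from hinf s).nonempty
    have h5 := hi.2
    rw [h4, hD0] at h5
    have h6 : 0 ≤ v s := hfnn _ hm
    have h7 : 0 ≤ 4 ^ s * v s := by positivity
    linarith
  obtain ⟨F, hFc, hFP, hdis, hge⟩ := select (fun s i => tp i = t s ∧ 4 ^ s * v s < D i (j s) (j' s))
    (fun s => hinf s) (fun s => ⌈(1/2:ℝ)^s / v s⌉₊)
  obtain ⟨J, hJ, hJF, hJ0⟩ := pick hdis t j hj (fun s i hi => (hFP s i hi).1)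
  obtain ⟨J', hJ', hJF', hJ0'⟩ := pick hdis t j' hj' (fun s i hi => (hFP s i hi).1)
  have hiff := hD J J' hJ hJ'
  refine not_summable_of_select (F := F) hge (fun s => ?_) (hiff.1 ?_)
  · have : ∀ i ∈ F s, 4 ^ s * v s ≤ D i (J i) (J' i) := by
      intro i hi
      rw [hJF s i hi, hJF' s i hi]
      exact (hFP s i hi).2.le
    refine le_trans ?_ (Finset.sum_le_sum this)
    rw [Finset.sum_const, hFc, nsmul_eq_mul]
    have h1 := (ceil_bound (b := (1/2:ℝ)^s) (by positivity) (hvpos s)).1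
    have h2 : (1:ℝ) ≤ 4 ^ s * (1/2:ℝ)^s := by
      rw [← mul_pow]; exact one_le_pow₀ (by norm_num)
    calc (1:ℝ) ≤ 4 ^ s * (1/2:ℝ)^s := h2
      _ ≤ 4 ^ s * (⌈(1/2:ℝ)^s / v s⌉₊ * v s) := by gcongr
      _ = _ := by ring
  · refine summable_of_select (F := F) (b := fun s => 2 * (1/2:ℝ)^s)
      (fun i => hfnn _ (grid_mem (hJ i) (hJ' i)))
      (fun i hi => ?_) hge (summable_geometric_two.mul_left 2) (fun s => by positivity) fun s => ?_
    · by_contra hno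
      push Not at hno
      apply hi
      rw [hJ0 i hno, hJ0' i hno]
      simp [hf0]
    · have : ∀ i ∈ F s, f |(J i : ℝ) / 2 ^ tp i - (J' i : ℝ) / 2 ^ tp i| = v s := by
        intro i hi
        rw [hJF s i hi, hJF' s i hi, (hFP s i hi).1]
      rw [Finset.sum_congr rfl this, Finset.sum_const, hFc, nsmul_eq_mul]
      have h1 := (ceil_bound (b := (1/2:ℝ)^s) (by positivity) (hvpos s)).2
      have h2 : (1/4:ℝ)^s ≤ (1/2:ℝ)^s := pow_le_pow_left₀ (by norm_num) (by norm_num) s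
      have h3 : v s ≤ (1/4:ℝ)^s := hf1 s
      linarith

end unif

lemma uniform_embedding {f g : ℝ → ℝ} (hf0 : f 0 = 0) (hfpos : ∀ t ∈ Ioc (0:ℝ) 1, 0 < f t)
    (h0 : g 0 = 0)
    (hnn : ∀ t ∈ Icc (0:ℝ) 1, 0 ≤ g t) (hgc : ContinuousOn g (Icc 0 1))
    {K : ℝ} (hK1 : 1 ≤ K) (hK : PTri K g) (hred : BorelReducible (EF f) (EF g)) :
    ∃ C : ℝ, 1 ≤ C ∧ ∃ η : ℝ, 0 < η ∧ ∀ t : ℕ, ∃ (S : Finset ℕ) (T : ℕ → ℕ → Icc (0:ℝ) 1),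
      ∀ j j' : ℕ, j ≤ 2 ^ t → j' ≤ 2 ^ t → f |(j : ℝ) / 2 ^ t - (j' : ℝ) / 2 ^ t| ≤ η →
        f |(j : ℝ) / 2 ^ t - (j' : ℝ) / 2 ^ t| ≤ C * ∑ n ∈ S, g |(T j n : ℝ) - T j' n| ∧
        ∑ n ∈ S, g |(T j n : ℝ) - T j' n| ≤ C * f |(j : ℝ) / 2 ^ t - (j' : ℝ) / 2 ^ t| := by
  obtain ⟨L, T, -, -, hD⟩ := additive hf0 h0 hnn hgc hK1 hK hred
  let D : ℕ → ℕ → ℕ → ℝ := fun i j j' => ∑ n ∈ Finset.Ico (L i) (L (i+1)),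
          g |(T i j n : ℝ) - T i j' n|
  have hDnn : ∀ i j j', 0 ≤ D i j j' := fun i j j' =>
    Finset.sum_nonneg fun n _ => hnn _ (abs_sub_mem (Subtype.prop _) (Subtype.prop _))
  have hD0 : ∀ i j, D i j j = 0 := fun i j => by simp [D, h0]
  obtain ⟨s1, hs1⟩ := unif_lower (D := D) hf0 hfpos hDnn hD0 hD
  obtain ⟨s2, hs2⟩ := unif_upper (D := D) hf0 hfpos hDnn hD0 hD
  have hfnn : ∀ x ∈ Icc (0:ℝ) 1, 0 ≤ f x := by
    intro x hx
    rcases hx.1.eq_or_lt with h | h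
    · rw [← h, hf0]
    · exact (hfpos x ⟨h, hx.2⟩).le
  refine ⟨4 ^ (s1 + s2), one_le_pow₀ (by norm_num), (1/4:ℝ)^s2, by positivity, fun t => ?_⟩
  have hbad : {i | ∃ j : ℕ, j ≤ 2 ^ t ∧ ∃ j' : ℕ, j' ≤ 2 ^ t ∧
      f |(j : ℝ) / 2 ^ t - (j' : ℝ) / 2 ^ t| ≤ (1/4:ℝ)^s2 ∧
      (i ∈ {i | tp i = t ∧ 4 ^ s1 * D i j j' < f |(j : ℝ) / 2 ^ t - (j' : ℝ) / 2 ^ t|} ∨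
       i ∈ {i | tp i = t ∧ 4 ^ s2 * f |(j : ℝ) / 2 ^ t - (j' : ℝ) / 2 ^ t| < D i j j'})}.Finite := by
    have hfin : ({x : ℕ × ℕ | x.1 ≤ 2 ^ t ∧ x.2 ≤ 2 ^ t ∧
        f |(x.1 : ℝ) / 2 ^ t - (x.2 : ℝ) / 2 ^ t| ≤ (1/4:ℝ)^s2}).Finite :=
      ((finite_le_nat (2 ^ t)).prod (finite_le_nat (2 ^ t))).subset fun x hx => ⟨hx.1, hx.2.1⟩
    refine (hfin.biUnion (t := fun x => {i | tp i = t ∧ 4 ^ s1 * D i x.1 x.2 <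
        f |(x.1 : ℝ) / 2 ^ t - (x.2 : ℝ) / 2 ^ t|} ∪ {i | tp i = t ∧ 4 ^ s2 *
        f |(x.1 : ℝ) / 2 ^ t - (x.2 : ℝ) / 2 ^ t| < D i x.1 x.2}) fun x hx => ?_).subset ?_
    · exact (hs1 t _ _ hx.1 hx.2.1 (hx.2.2.trans (pow_le_one₀ (by norm_num) (by norm_num)))).union
        (hs2 t _ _ hx.1 hx.2.1 hx.2.2)
    · rintro i ⟨j, hj, j', hj', hf, h⟩
      exact mem_biUnion (x := (j, j')) ⟨hj, hj', hf⟩ h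
  have hinf : {i | tp i = t}.Infinite := by
    refine infinite_of_injective_forall_mem (f := fun r => Nat.pair t r) ?_ fun r => by simp [tp]
    intro r r' h
    have := congrArg (fun n => (Nat.unpair n).2) h
    simpa using this
  obtain ⟨i, hi, hib⟩ := (hinf.sdiff hbad).nonempty
  refine ⟨Finset.Ico (L i) (L (i+1)), T i, fun j j' hj hj' hf => ?_⟩
  have hno : ∀ P Q : Prop, (¬ (P ∨ Q)) → ¬ P ∧ ¬ Q := fun P Q h => not_or.1 h
  have h1 := not_or.1 fun h => hib ⟨j, hj, j', hj', hf, h⟩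
  have h2 : f |(j : ℝ) / 2 ^ t - (j' : ℝ) / 2 ^ t| ≤ 4 ^ s1 * D i j j' := by
    by_contra h; exact h1.1 ⟨hi, not_le.1 h⟩
  have h3 : D i j j' ≤ 4 ^ s2 * f |(j : ℝ) / 2 ^ t - (j' : ℝ) / 2 ^ t| := by
    by_contra h; exact h1.2 ⟨hi, not_le.1 h⟩
  have h4 := hDnn i j j'
  have h5 := hfnn _ (grid_mem hj hj')
  constructor
  · refine h2.trans (mul_le_mul_of_nonneg_right ?_ h4)
    exact pow_le_pow_right₀ (by norm_num) (by omega)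
  · refine h3.trans (mul_le_mul_of_nonneg_right ?_ h5)
    exact pow_le_pow_right₀ (by norm_num) (by omega)

/-! ### The sequences `u` and the functions `φ_U` -/

structure USeq (v : ℕ → ℝ) : Prop where
  pos : ∀ n, 0 < v n
  anti : Antitone v
  zero : v 0 = 1
  dbl : ∃ C : ℝ, 1 ≤ C ∧ ∀ n, v n ≤ C * v (2 * n + 2)
  poly : ∃ p : ℕ, ∀ n : ℕ, 1 ≤ ((n : ℝ) + 1) ^ p * v n

lemma exists_dyadic {x : ℝ} (hx : 0 < x) (hx1 : x ≤ 1) :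
    ∃ n : ℕ, (1/2:ℝ) ^ (n+1) < x ∧ x ≤ (1/2:ℝ) ^ n := by
  obtain ⟨n, h1, h2⟩ := exists_nat_pow_near_of_lt_one hx hx1 (by norm_num : (0:ℝ) < 1/2)
    (by norm_num)
  exact ⟨n, h1, h2⟩

lemma half_mem (n : ℕ) : (1/2:ℝ) ^ n ∈ Icc (0:ℝ) 1 :=
  ⟨by positivity, pow_le_one₀ (by norm_num) (by norm_num)⟩

lemma slow_of {φ ω : ℝ → ℝ} {v : ℕ → ℝ} (hv : USeq v)
    (hφc : ContinuousOn φ (Icc 0 1)) (hφei : EssIncOn φ (Icc 0 1))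
    (hφnn : ∀ t ∈ Icc (0:ℝ) 1, 0 ≤ φ t) (hφpos : ∀ t ∈ Ioc (0:ℝ) 1, 0 < φ t)
    (hlam : ∃ lam > (0:ℝ), ∀ t ∈ Icc (0:ℝ) 1, lam * φ t ≤ φ (t^2))
    (hc : ContinuousOn ω (Icc 0 1)) (hm : MonotoneOn ω (Icc 0 1))
    (hnn : ∀ t ∈ Icc (0:ℝ) 1, 0 ≤ ω t) (hval : ∀ n : ℕ, ω ((1/2:ℝ)^n) = v n) :
    Slow (fun t => φ t * ω t) := by
  obtain ⟨C1, hC1, h1⟩ := hφei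
  obtain ⟨lam, hl, h2⟩ := hlam
  obtain ⟨C2, hC2, h3⟩ := hv.dbl
  have hpos : ∀ t ∈ Ioc (0:ℝ) 1, 0 < ω t := by
    intro t ht
    obtain ⟨n, hn, -⟩ := exists_dyadic ht.1 ht.2
    refine (hv.pos (n+1)).trans_le ?_
    rw [← hval]
    exact hm (half_mem _) ⟨ht.1.le, ht.2⟩ hn.le
  have hω : ∀ x ∈ Icc (0:ℝ) 1, ∀ t ∈ Icc (0:ℝ) 1, x ^ 2 ≤ t → ω x ≤ C2 * ω t := by
    intro x hx t ht hxt
    rcases hx.1.eq_or_lt with h | h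
    · have : ω x ≤ ω t := hm hx ht (by rw [← h]; exact ht.1)
      nlinarith [hnn t ht]
    · obtain ⟨n, hn1, hn2⟩ := exists_dyadic h hx.2
      have a1 : ω x ≤ v n := by rw [← hval]; exact hm hx (half_mem _) hn2
      have a2 : v (2 * n + 2) ≤ ω t := by
        rw [← hval]
        refine hm (half_mem _) ht (le_trans ?_ hxt)
        rw [show 2 * n + 2 = (n + 1) * 2 by ring, pow_mul]
        exact pow_le_pow_left₀ (by positivity) hn1.le 2
      calc ω x ≤ v n := a1
        _ ≤ C2 * v (2 * n + 2) := h3 n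
        _ ≤ C2 * ω t := by gcongr
  have hφ : ∀ x ∈ Icc (0:ℝ) 1, ∀ t ∈ Icc (0:ℝ) 1, x ^ 2 ≤ t → φ x ≤ C1 / lam * φ t := by
    intro x hx t ht hxt
    have a1 := h2 x hx
    have a2 := h1 (x^2) ⟨by positivity, pow_le_one₀ hx.1 hx.2⟩ t ht hxt
    rw [div_mul_eq_mul_div, le_div_iff₀ hl]
    linarith
  refine ⟨hφc.mul hc, fun t ht => mul_nonneg (hφnn t ht) (hnn t ht),
    fun t ht => mul_pos (hφpos t ht) (hpos t ht), max 1 (C1 / lam * C2), le_max_left _ _, ?_⟩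
  intro x hx t ht hxt
  have b1 := hφ x hx t ht hxt
  have b2 := hω x hx t ht hxt
  have b3 := hφnn t ht
  have b4 := hnn t ht
  calc φ x * ω x ≤ (C1 / lam * φ t) * (C2 * ω t) :=
        mul_le_mul b1 b2 (hnn x hx) (by positivity)
    _ = (C1 / lam * C2) * (φ t * ω t) := by ring
    _ ≤ _ := mul_le_mul_of_nonneg_right (le_max_right _ _) (by positivity)

lemma exists_count {k : ℕ → ℕ} (hk : StrictMono k) :
    ∃ c : ℕ → ℕ, ∀ m n, m < c n ↔ k m ≤ n := by
  have h : ∀ n, ∃ m, n < k m := fun n => ⟨n + 1, (Nat.lt_succ_self n).trans_le (hk.id_le _)⟩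
  refine ⟨fun n => Nat.find (h n), fun m n => ?_⟩
  rw [Nat.lt_find_iff]
  constructor
  · intro h1; exact not_lt.1 (h1 m le_rfl)
  · intro h1 j hj; exact not_lt.2 ((hk.monotone hj).trans h1)

section count
variable {k c : ℕ → ℕ}

lemma count_succ_of (hc : ∀ m n, m < c n ↔ k m ≤ n) (hk : StrictMono k) {n m : ℕ} (h : n + 1 = k m) :
    c n = m ∧ c (n+1) = m + 1 := by
  have e1 := hc m n
  have e2 := hc m (n+1)
  have e3 := hc (m+1) (n+1)
  have e4 := hk (Nat.lt_succ_self m)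
  have e5 : m - 1 < m → k (m-1) < k m := fun h => hk h
  have e6 := hc (m-1) n
  rw [Nat.succ_eq_add_one] at e4
  constructor
  · rcases Nat.eq_zero_or_pos m with h0 | h0
    · omega
    · have := e5 (by omega); omega
  · omega

lemma count_succ_of_not (hc : ∀ m n, m < c n ↔ k m ≤ n) {n : ℕ} (h : ∀ m, n + 1 ≠ k m) :
    c (n+1) = c n := by
  refine eq_of_forall_lt_iff fun m => ?_
  rw [hc, hc]
  have := h m
  omega

lemma count_mono (hc : ∀ m n, m < c n ↔ k m ≤ n) : Monotone c := by
  intro n n' h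
  by_contra hcon
  have := (hc (c n') n).1 (not_le.1 hcon)
  have := (hc (c n') n').2 (this.trans h)
  omega

lemma count_zero (hc : ∀ m n, m < c n ↔ k m ≤ n) (hk0 : 2 ≤ k 0) : c 0 = 0 := by
  have := hc 0 0
  omega

lemma count_dbl (hc : ∀ m n, m < c n ↔ k m ≤ n) (hk2 : ∀ m, 2 * k m ≤ k (m+1)) (n : ℕ) :
    c (2 * n + 2) ≤ c n + 2 := by
  by_contra h
  have h1 := (hc (c n + 2) (2 * n + 2)).1 (by omega)
  have h2 := hc (c n) n
  have h3 := hk2 (c n)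
  have h4 := hk2 (c n + 1)
  have h5 : c n + 1 + 1 = c n + 2 := rfl
  rw [h5] at h4
  omega

lemma count_pow (hc : ∀ m n, m < c n ↔ k m ≤ n) (hk0 : 2 ≤ k 0)
    (hk2 : ∀ m, 2 * k m ≤ k (m+1)) (n : ℕ) : 2 ^ c n ≤ n + 1 := by
  have hk : ∀ m, 2 ^ (m+1) ≤ k m := by
    intro m
    induction m with
    | zero => simpa using hk0
    | succ m ih => have := hk2 m; rw [pow_succ]; omega
  rcases h : c n with _ | m
  · simp
  · have := (hc m n).1 (by omega)
    have := hk m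
    omega

end count

lemma useq_of {k c : ℕ → ℕ} (hc : ∀ m n, m < c n ↔ k m ≤ n) (hk0 : 2 ≤ k 0)
    (hk2 : ∀ m, 2 * k m ≤ k (m+1)) {ρ : ℕ → ℝ} {lo : ℝ} (hlo : 0 < lo) (hρ : ∀ j, lo ≤ ρ j)
    (hρ1 : ∀ j, ρ j ≤ 1) : USeq (fun n => ∏ j ∈ Finset.range (c n), ρ j) := by
  have hpos : ∀ j, 0 < ρ j := fun j => hlo.trans_le (hρ j)
  have hlo1 : lo ≤ 1 := (hρ 0).trans (hρ1 0)
  have hanti : Antitone (fun m => ∏ j ∈ Finset.range m, ρ j) := by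
    refine antitone_nat_of_succ_le fun m => ?_
    rw [Finset.prod_range_succ]
    exact mul_le_of_le_one_right (Finset.prod_nonneg fun j _ => (hpos j).le) (hρ1 m)
  refine ⟨fun n => Finset.prod_pos fun j _ => hpos j, fun n n' h => hanti (count_mono hc h),
    by simp [count_zero hc hk0], ⟨1 / lo ^ 2, ?_, fun n => ?_⟩, ?_⟩
  · rw [le_div_iff₀ (by positivity), one_mul]; exact pow_le_one₀ hlo.le hlo1
  · have h1 := hanti (count_dbl hc hk2 n)
    simp only at h1
    rw [Finset.prod_range_succ, Finset.prod_range_succ] at h1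
    rw [one_div, inv_mul_eq_div, le_div_iff₀ (by positivity)]
    refine le_trans ?_ h1
    have hP : 0 ≤ ∏ j ∈ Finset.range (c n), ρ j := Finset.prod_nonneg fun j _ => (hpos j).le
    rw [mul_assoc]
    refine mul_le_mul_of_nonneg_left ?_ hP
    rw [pow_two]
    exact mul_le_mul (hρ _) (hρ _) hlo.le (hpos _).le
  · obtain ⟨p, hp⟩ := exists_pow_lt_of_lt_one hlo (by norm_num : (1/2:ℝ) < 1)
    refine ⟨p, fun n => ?_⟩
    have h1 : lo ^ c n ≤ ∏ j ∈ Finset.range (c n), ρ j := by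
      have := Finset.prod_le_prod (s := Finset.range (c n)) (f := fun _ => lo) (g := ρ)
        (fun _ _ => hlo.le) (fun j _ => hρ j)
      simpa using this
    have h2 : ((1/2:ℝ) ^ p) ^ c n ≤ lo ^ c n := pow_le_pow_left₀ (by positivity) hp.le _
    have h3 : ((2:ℝ) ^ c n) ≤ (n:ℝ) + 1 := by exact_mod_cast count_pow hc hk0 hk2 n
    calc (1:ℝ) = (2 ^ c n) ^ p * ((1/2:ℝ) ^ p) ^ c n := by
          rw [← pow_mul, ← pow_mul, mul_comm p, ← mul_pow]; norm_num
      _ ≤ ((n:ℝ) + 1) ^ p * ∏ j ∈ Finset.range (c n), ρ j := by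
          have := h2.trans h1
          gcongr

/-! ### Non-reducibility -/

lemma spread {α A Cs : ℝ} (hα : 1 ≤ α) (hA : 1 ≤ A) (hCs : 1 ≤ Cs) {ψ : ℝ → ℝ}
    (hnn : ∀ t ∈ Icc (0:ℝ) 1, 0 ≤ ψ t)
    (hs : ∀ x ∈ Icc (0:ℝ) 1, ∀ t ∈ Icc (0:ℝ) 1, x ^ 2 ≤ t → ψ x ≤ Cs * ψ t)
    {n0 n : ℕ} (hn0 : 1 ≤ n0) (hn : n0 ≤ n) {Q : ℝ} (hQ : 1 ≤ A * Q) 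
    (hQψ : ψ ((1/2)^n0) = Q * ψ ((1/2)^n)) {d : ℝ} (hd : d ∈ Icc (0:ℝ) 1)
    (hdr : d ^ 2 ≤ (1/2)^n0) {e : ℕ → ℝ} (he : ∀ s, e s ∈ Icc (0:ℝ) 1)
    (hde : d ≤ ∑ s ∈ Finset.range (2 ^ (n - n0)), e s) :
    Fn α ψ d ≤ (2 ^ α * A * Cs ^ 3) * ((2:ℝ) ^ (n - n0)) ^ (α - 1) * Q *
      ∑ s ∈ Finset.range (2 ^ (n - n0)), Fn α ψ (e s) := by
  classical
  set N : ℝ := (2:ℝ) ^ (n - n0) with hN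
  have hN1 : 1 ≤ N := one_le_pow₀ (by norm_num)
  have hQ0 : 0 < Q := by
    by_contra h
    have := mul_nonneg_of_nonpos_of_nonpos (a := -A) (b := Q) (by linarith) (not_lt.1 h)
    linarith
  have hx : d / (2 * N) ∈ Icc (0:ℝ) 1 := by
    refine ⟨div_nonneg hd.1 (by linarith), ?_⟩
    rw [div_le_one (by linarith)]; linarith [hd.2]
  have hxn := hnn _ hx
  have key : ψ d ≤ Cs * Cs * A * Q * ψ (d / (2 * N)) := by
    rcases le_or_gt d (1 / (2 * N)) with h | h
    · have h1 : d ^ 2 ≤ d / (2 * N) := by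
        rw [pow_two, div_eq_mul_one_div]
        exact mul_le_mul_of_nonneg_left h hd.1
      calc ψ d ≤ Cs * ψ (d / (2 * N)) := hs d hd _ hx h1
        _ ≤ Cs * ((Cs * (A * Q)) * ψ (d / (2 * N))) := by
            refine mul_le_mul_of_nonneg_left ?_ (by linarith)
            refine le_mul_of_one_le_left hxn ?_
            exact one_le_mul_of_one_le_of_one_le hCs hQ
        _ = _ := by ring
    · have h2 : ((1/2:ℝ)^n) ^ 2 ≤ d / (2 * N) := by
        have hNn : N * (1/2:ℝ) ^ n = (1/2:ℝ) ^ n0 := by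
          have : (1/2:ℝ) ^ n = (1/2:ℝ) ^ (n - n0) * (1/2:ℝ) ^ n0 := by
            rw [← pow_add]; congr 1; omega
          rw [this, ← mul_assoc, hN, ← mul_pow]; norm_num
        have h3 : (1/2:ℝ) ^ n0 ≤ 1/2 := by
          calc (1/2:ℝ) ^ n0 ≤ (1/2:ℝ) ^ 1 := pow_le_pow_of_le_one (by norm_num) (by norm_num) hn0
            _ = 1/2 := by norm_num
        have h4 : (0:ℝ) < (1/2:ℝ) ^ n := by positivity
        rw [le_div_iff₀ (by linarith)]
        have h5 : 2 * (N * (1/2:ℝ) ^ n) ≤ 1 := by rw [hNn]; linarith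
        have h6 : (1/2:ℝ) ^ n ≤ 1 / (2 * N) := by
          rw [le_div_iff₀ (by linarith)]; linarith
        calc ((1/2:ℝ)^n) ^ 2 * (2 * N) = (1/2:ℝ) ^ n * (2 * (N * (1/2:ℝ) ^ n)) := by ring
          _ ≤ (1/2:ℝ) ^ n * 1 := by gcongr
          _ ≤ d := by linarith
      calc ψ d ≤ Cs * ψ ((1/2)^n0) := hs d hd _ (half_mem _) hdr
        _ = Cs * Q * ψ ((1/2)^n) := by rw [hQψ]; ring
        _ ≤ Cs * Q * (Cs * ψ (d / (2 * N))) := by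
            gcongr
            exact hs _ (half_mem _) _ hx h2
        _ = 1 * (Cs * Cs * Q * ψ (d / (2 * N))) := by ring
        _ ≤ A * (Cs * Cs * Q * ψ (d / (2 * N))) := by
            refine mul_le_mul_of_nonneg_right hA ?_
            positivity
        _ = _ := by ring
  set S := (Finset.range (2 ^ (n - n0))).filter (fun s => d / (2 * N) ≤ e s) with hS
  have hsumS : d / 2 ≤ ∑ s ∈ S, e s := by
    have h1 := Finset.sum_filter_add_sum_filter_not (Finset.range (2 ^ (n - n0)))
      (fun s => d / (2 * N) ≤ e s) e
    have h2 : ∑ s ∈ (Finset.range (2 ^ (n - n0))).filter (fun s => ¬ d / (2 * N) ≤ e s), e s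
        ≤ d / 2 := by
      calc _ ≤ ∑ s ∈ (Finset.range (2 ^ (n - n0))).filter (fun s => ¬ d / (2 * N) ≤ e s),
            d / (2 * N) := Finset.sum_le_sum fun s hs => (not_le.1 (Finset.mem_filter.1 hs).2).le
        _ ≤ ∑ s ∈ (Finset.range (2 ^ (n - n0))), d / (2 * N) :=
            Finset.sum_le_sum_of_subset_of_nonneg (Finset.filter_subset _ _) fun _ _ _ => hx.1
        _ = d / 2 := by
            rw [Finset.sum_const, Finset.card_range, nsmul_eq_mul]; push_cast
            rw [← hN]; field_simp
    linarith
  have hpm : (d / 2) ^ α ≤ N ^ (α - 1) * ∑ s ∈ S, (e s) ^ α := by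
    have h1 := Real.rpow_sum_le_const_mul_sum_rpow S e hα
    have h2 : ∀ s ∈ S, |e s| = e s := fun s _ => abs_of_nonneg (he s).1
    have h2' : ∀ s ∈ S, |e s| ^ α = e s ^ α := fun s hs => by rw [h2 s hs]
    rw [Finset.sum_congr rfl h2, Finset.sum_congr rfl h2'] at h1
    have h3 : (S.card : ℝ) ≤ N := by
      have : S.card ≤ 2 ^ (n - n0) := by
        simpa using Finset.card_filter_le (Finset.range (2 ^ (n - n0))) (fun s => d / (2 * N) ≤ e s)
      rw [hN]; exact_mod_cast this
    calc (d / 2) ^ α ≤ (∑ s ∈ S, e s) ^ α :=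
          Real.rpow_le_rpow (by linarith [hd.1]) hsumS (by linarith)
      _ ≤ _ := h1
      _ ≤ _ := by
          refine mul_le_mul_of_nonneg_right ?_
            (Finset.sum_nonneg fun s _ => Real.rpow_nonneg (he s).1 _)
          exact Real.rpow_le_rpow (by positivity) h3 (by linarith)
  have hdα : d ^ α = 2 ^ α * (d / 2) ^ α := by
    rw [← Real.mul_rpow (by norm_num) (by linarith [hd.1])]; congr 1; ring
  have hterm : ∀ s ∈ S, e s ^ α * ψ (d / (2 * N)) ≤ Cs * Fn α ψ (e s) := by
    intro s hsS
    have h1 := (Finset.mem_filter.1 hsS).2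
    have h2 := hs _ hx _ (he s) (by nlinarith [hx.1, hx.2])
    have h3 := Real.rpow_nonneg (he s).1 α
    unfold Fn
    calc e s ^ α * ψ (d / (2 * N)) ≤ e s ^ α * (Cs * ψ (e s)) := by gcongr
      _ = _ := by ring
  have hNp : 0 ≤ N ^ (α - 1) := by positivity
  have h2p : (0:ℝ) ≤ 2 ^ α := by positivity
  calc Fn α ψ d = 2 ^ α * (d / 2) ^ α * ψ d := by rw [Fn, hdα]
    _ ≤ 2 ^ α * (N ^ (α - 1) * ∑ s ∈ S, (e s) ^ α) * (Cs * Cs * A * Q * ψ (d / (2 * N))) := by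
        refine mul_le_mul (mul_le_mul_of_nonneg_left hpm h2p) key (hnn d hd) ?_
        refine mul_nonneg h2p (mul_nonneg hNp (Finset.sum_nonneg fun s _ =>
          Real.rpow_nonneg (he s).1 _))
    _ = 2 ^ α * N ^ (α - 1) * (Cs * Cs * A * Q) * ∑ s ∈ S, (e s) ^ α * ψ (d / (2 * N)) := by
        rw [← Finset.sum_mul]; ring
    _ ≤ 2 ^ α * N ^ (α - 1) * (Cs * Cs * A * Q) * ∑ s ∈ S, Cs * Fn α ψ (e s) := by
        refine mul_le_mul_of_nonneg_left (Finset.sum_le_sum hterm) (by positivity)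
    _ ≤ 2 ^ α * N ^ (α - 1) * (Cs * Cs * A * Q) *
          ∑ s ∈ Finset.range (2 ^ (n - n0)), Cs * Fn α ψ (e s) := by
        refine mul_le_mul_of_nonneg_left ?_ (by positivity)
        refine Finset.sum_le_sum_of_subset_of_nonneg (Finset.filter_subset _ _) fun s _ _ => ?_
        refine mul_nonneg (by linarith) (mul_nonneg (Real.rpow_nonneg (he s).1 _) (hnn _ (he s)))
    _ = _ := by rw [← Finset.mul_sum]; ring

lemma poly_small (B : ℝ) (p : ℕ) :
    ∀ᶠ n : ℕ in Filter.atTop, B * ((n : ℝ) + 1) ^ p * (1/2:ℝ) ^ n < 1 := by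
  have h := tendsto_pow_const_mul_const_pow_of_abs_lt_one p (r := (1/2:ℝ))
    (by rw [abs_of_pos] <;> norm_num)
  have h1 := ((Filter.tendsto_add_atTop_iff_nat 1).2 h).const_mul (2 * B)
  rw [mul_zero] at h1
  filter_upwards [h1.eventually (gt_mem_nhds one_pos)] with n hn
  refine lt_of_eq_of_lt ?_ hn
  push_cast
  ring

lemma part3 {α : ℝ} (hα : 1 ≤ α) {φ ωU ωV : ℝ → ℝ} {u v : ℕ → ℝ} (hu : USeq u) (hv : USeq v)
    (hφei : EssIncOn φ (Icc 0 1)) (hφpos : ∀ t ∈ Ioc (0:ℝ) 1, 0 < φ t)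
    (hvalU : ∀ n : ℕ, ωU ((1/2:ℝ)^n) = u n) (hvalV : ∀ n : ℕ, ωV ((1/2:ℝ)^n) = v n)
    (hU : Slow (fun t => φ t * ωU t)) (hV : Slow (fun t => φ t * ωV t))
    (hsep : ∀ B : ℝ, ∀ n1 : ℕ, ∃ n0 n, n1 ≤ n0 ∧ n0 ≤ n ∧ v n0 = v n ∧ B * u n < u n0) :
    ¬ BorelReducible (EF (Fn α (fun t => φ t * ωU t))) (EF (Fn α (fun t => φ t * ωV t))) := by
  intro hred
  set ψU := fun t => φ t * ωU t with hψU
  set ψV := fun t => φ t * ωV t with hψV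
  obtain ⟨K, hK1, hK⟩ := Fn_tri hα hV
  obtain ⟨C, hC, η, hη, hemb⟩ := uniform_embedding (Fn_zero hα ψU) (Fn_pos hU) (Fn_zero hα ψV)
    (Fn_nn hV) (Fn_cont hα hV) hK1 hK hred
  obtain ⟨A, hA, hφ⟩ := hφei
  obtain ⟨Cs, hCs, hs⟩ := hV.slow
  obtain ⟨p, hp⟩ := hv.poly
  have hφh : ∀ n : ℕ, 0 < φ ((1/2:ℝ)^n) := fun n => hφpos _ ⟨by positivity, (half_mem n).2⟩
  -- smallness
  have hsm : ∀ᶠ n : ℕ in Filter.atTop, Fn α ψU ((1/2:ℝ)^n) ≤ η := by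
    have h1 : Filter.Tendsto (fun n : ℕ => (1/2:ℝ)^n) Filter.atTop (nhdsWithin 0 (Icc 0 1)) := by
      refine tendsto_nhdsWithin_iff.2 ⟨tendsto_pow_atTop_nhds_zero_of_lt_one (by norm_num)
        (by norm_num), Filter.Eventually.of_forall half_mem⟩
    have h2 := ((Fn_cont hα hU) 0 ⟨le_rfl, zero_le_one⟩).tendsto.comp h1
    rw [Fn_zero hα] at h2
    filter_upwards [h2.eventually (gt_mem_nhds hη)] with n hn
    exact hn.le
  obtain ⟨n1, hn1⟩ := Filter.eventually_atTop.1 (hsm.and (poly_small ((C * Cs)^2) (p * 2)))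
  obtain ⟨n0, n, h10, hn, hvn, hun⟩ := hsep (C * (2 ^ α * A * Cs ^ 3) * C) (max n1 1)
  have hn0 : 1 ≤ n0 := (le_max_right _ _).trans h10
  have hn10 : n1 ≤ n0 := (le_max_left _ _).trans h10
  obtain ⟨S, T, hT⟩ := hemb n
  set Nn : ℕ := 2 ^ (n - n0) with hNn
  have hNle : Nn ≤ 2 ^ n := Nat.pow_le_pow_right (by norm_num) (by omega)
  have hNh : (Nn : ℝ) * (1/2:ℝ) ^ n = (1/2:ℝ) ^ n0 := by
    have : (1/2:ℝ) ^ n = (1/2:ℝ) ^ (n - n0) * (1/2:ℝ) ^ n0 := by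
      rw [← pow_add]; congr 1; omega
    rw [this, ← mul_assoc, hNn]; push_cast; rw [← mul_pow]; norm_num
  have hdist0 : |((0:ℕ):ℝ) / 2 ^ n - (Nn:ℝ) / 2 ^ n| = (1/2:ℝ)^n0 := by
    rw [← hNh]
    rw [Nat.cast_zero, zero_div, zero_sub, abs_neg, abs_of_nonneg (by positivity), one_div,
      inv_pow, div_eq_mul_inv]
  have hdist : ∀ s : ℕ, |(s:ℝ) / 2 ^ n - ((s+1:ℕ):ℝ) / 2 ^ n| = (1/2:ℝ)^n := by
    intro s
    rw [← sub_div]; push_cast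
    rw [show (s:ℝ) - (s + 1) = -1 by ring, abs_div, abs_neg, abs_one,
      abs_of_pos (by positivity : (0:ℝ) < 2 ^ n)]
    simp
  have hT0 := hT 0 Nn (Nat.zero_le _) hNle (by rw [hdist0]; exact (hn1 n0 hn10).1)
  rw [hdist0] at hT0
  have hTs : ∀ s < Nn, ∑ j ∈ S, Fn α ψV |(T s j : ℝ) - T (s+1) j| ≤ C * Fn α ψU ((1/2:ℝ)^n) := by
    intro s hs
    have := hT s (s+1) (by omega) (by omega) (by rw [hdist]; exact (hn1 n (by omega)).1)
    rw [hdist] at this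
    exact this.2
  have hmem : ∀ s s' j, |(T s j : ℝ) - T s' j| ∈ Icc (0:ℝ) 1 := fun s s' j =>
    abs_sub_mem (Subtype.prop _) (Subtype.prop _)
  have hfU : ∀ n : ℕ, Fn α ψU ((1/2:ℝ)^n) = ((1/2:ℝ)^n) ^ α * φ ((1/2:ℝ)^n) * u n := by
    intro n; simp only [Fn, hψU, hvalU]; ring
  have hψVh : ∀ n : ℕ, ψV ((1/2:ℝ)^n) = φ ((1/2:ℝ)^n) * v n := by
    intro n; simp only [hψV, hvalV]
  -- (a)
  have hda : ∀ j ∈ S, |(T 0 j : ℝ) - T Nn j| ^ 2 ≤ (1/2:ℝ)^n0 := by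
    intro j hj
    by_contra hcon
    set d := |(T 0 j : ℝ) - T Nn j| with hd
    have hdm : d ∈ Icc (0:ℝ) 1 := hmem 0 Nn j
    set r := (1/2:ℝ)^n0 with hr
    have hr0 : 0 < r := by positivity
    have hrd : r < d ^ 2 := not_le.1 hcon
    have a1 : Fn α ψV d ≤ C * Fn α ψU r := by
      refine le_trans ?_ hT0.2
      exact Finset.single_le_sum (f := fun j => Fn α ψV |(T 0 j : ℝ) - T Nn j|)
        (fun i _ => Fn_nn hV _ (hmem 0 Nn i)) hj
    have a2 : ψV r ≤ Cs * ψV d := by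
      refine hs r (half_mem _) d hdm ?_
      have := (half_mem n0).2
      nlinarith [hdm.1, hdm.2]
    have a3 : (0:ℝ) ≤ d ^ α := Real.rpow_nonneg hdm.1 _
    have a4 : d ^ α * (φ r * v n0) ≤ (C * Cs * r ^ α) * φ r := by
      rw [← hψVh]
      have hu1 : u n0 ≤ 1 := by rw [← hu.zero]; exact hu.anti (Nat.zero_le _)
      calc d ^ α * ψV r ≤ d ^ α * (Cs * ψV d) := by gcongr
        _ = Cs * Fn α ψV d := by rw [Fn]; ring
        _ ≤ Cs * (C * Fn α ψU r) := by gcongr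
        _ = (C * Cs * r ^ α) * φ r * u n0 := by rw [hfU]; ring
        _ ≤ (C * Cs * r ^ α) * φ r := by
            refine mul_le_of_le_one_right ?_ hu1
            have := (hφh n0).le
            positivity
    have a5 : d ^ α * v n0 ≤ C * Cs * r ^ α := by
      refine le_of_mul_le_mul_right ?_ (hφh n0)
      calc _ = d ^ α * (φ r * v n0) := by ring
        _ ≤ _ := a4
    have hrα : 0 < r ^ α := Real.rpow_pos_of_pos hr0 _
    have a6 : r ^ α ≤ (d ^ α) ^ 2 := by
      rw [← Real.rpow_natCast, ← Real.rpow_mul hdm.1, mul_comm, Real.rpow_mul hdm.1,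
        Real.rpow_natCast]
      exact Real.rpow_le_rpow hr0.le hrd.le (by linarith)
    have a7 : r ^ α * v n0 ^ 2 ≤ (C * Cs) ^ 2 * (r ^ α) * r ^ α := by
      calc r ^ α * v n0 ^ 2 ≤ (d ^ α) ^ 2 * v n0 ^ 2 := by gcongr
        _ = (d ^ α * v n0) ^ 2 := by ring
        _ ≤ (C * Cs * r ^ α) ^ 2 := by
            have := hv.pos n0
            gcongr
        _ = _ := by ring
    have a8 : v n0 ^ 2 ≤ (C * Cs) ^ 2 * r ^ α := by
      refine le_of_mul_le_mul_left ?_ hrα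
      linarith
    have a9 : r ^ α ≤ r := by
      have := Real.rpow_le_rpow_of_exponent_ge hr0 (half_mem n0).2 hα
      rwa [Real.rpow_one] at this
    have b1 := (hn1 n0 hn10).2
    have b2 := hp n0
    have b3 : (1:ℝ) ≤ (((n0:ℝ) + 1) ^ p * v n0) ^ 2 := one_le_pow₀ b2
    have b4 : (((n0:ℝ) + 1) ^ p * v n0) ^ 2 ≤ (C * Cs) ^ 2 * ((n0:ℝ) + 1) ^ (p * 2) * r := by
      calc (((n0:ℝ) + 1) ^ p * v n0) ^ 2 = ((n0:ℝ) + 1) ^ (p * 2) * v n0 ^ 2 := by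
            rw [mul_pow, ← pow_mul]
        _ ≤ ((n0:ℝ) + 1) ^ (p * 2) * ((C * Cs) ^ 2 * r) := by
            refine mul_le_mul_of_nonneg_left (a8.trans ?_) (by positivity)
            gcongr
        _ = _ := by ring
    linarith
  -- (b)
  set Q := φ ((1/2:ℝ)^n0) / φ ((1/2:ℝ)^n) with hQ
  have hQ1 : 1 ≤ A * Q := by
    rw [hQ, ← mul_div_assoc, le_div_iff₀ (hφh n), one_mul]
    exact hφ _ (half_mem _) _ (half_mem _) (pow_le_pow_of_le_one (by norm_num) (by norm_num) hn)
  have hQ0 : 0 < Q := div_pos (hφh _) (hφh _)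
  have hQψ : ψV ((1/2)^n0) = Q * ψV ((1/2)^n) := by
    rw [hψVh, hψVh, hvn, hQ]
    have := (hφh n).ne'
    field_simp
  have hb : ∀ j ∈ S, Fn α ψV |(T 0 j : ℝ) - T Nn j| ≤
      (2 ^ α * A * Cs ^ 3) * ((2:ℝ) ^ (n - n0)) ^ (α - 1) * Q *
      ∑ s ∈ Finset.range Nn, Fn α ψV |(T s j : ℝ) - T (s+1) j| := by
    intro j hj
    refine spread hα hA hCs hV.nn hs hn0 hn hQ1 hQψ (hmem 0 Nn j) (hda j hj)
      (e := fun s => |(T s j : ℝ) - T (s+1) j|) (fun s => hmem _ _ _) ?_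
    have := dist_le_range_sum_dist (fun s => (T s j : ℝ)) Nn
    simpa [Real.dist_eq] using this
  -- (c)
  have hfin : Fn α ψU ((1/2:ℝ)^n0) ≤ C * ((2 ^ α * A * Cs ^ 3) *
      ((2:ℝ) ^ (n - n0)) ^ (α - 1) * Q * (Nn * (C * Fn α ψU ((1/2:ℝ)^n)))) := by
    refine hT0.1.trans (mul_le_mul_of_nonneg_left ?_ (by linarith))
    refine (Finset.sum_le_sum hb).trans ?_
    rw [← Finset.mul_sum]
    refine mul_le_mul_of_nonneg_left ?_ (by positivity)
    rw [Finset.sum_comm]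
    refine (Finset.sum_le_sum fun s hs => hTs s (Finset.mem_range.1 hs)).trans ?_
    rw [Finset.sum_const, Finset.card_range, nsmul_eq_mul]
  rw [hfU, hfU] at hfin
  have hN0 : (0:ℝ) < (2:ℝ) ^ (n - n0) := by positivity
  have e1 : ((2:ℝ) ^ (n - n0)) ^ (α - 1) * (Nn * ((1/2:ℝ)^n) ^ α) = ((1/2:ℝ)^n0) ^ α := by
    rw [← hNh, Real.mul_rpow (by positivity) (by positivity), ← mul_assoc]
    congr 1
    rw [hNn]; push_cast
    rw [Real.rpow_sub_one hN0.ne']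
    field_simp
  have e2 : Q * φ ((1/2:ℝ)^n) = φ ((1/2:ℝ)^n0) := by
    rw [hQ]; have := (hφh n).ne'; field_simp
  have e3 : C * ((2 ^ α * A * Cs ^ 3) *
      ((2:ℝ) ^ (n - n0)) ^ (α - 1) * Q * (Nn * (C * (((1/2:ℝ)^n) ^ α * φ ((1/2:ℝ)^n) * u n)))) =
      (((1/2:ℝ)^n0) ^ α * φ ((1/2:ℝ)^n0)) * (C * (2 ^ α * A * Cs ^ 3) * C * u n) := by
    rw [← e1, ← e2]; ring
  rw [e3] at hfin
  have hpp : 0 < ((1/2:ℝ)^n0) ^ α * φ ((1/2:ℝ)^n0) :=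
    mul_pos (Real.rpow_pos_of_pos (by positivity) _) (hφh n0)
  have := le_of_mul_le_mul_left hfin hpp
  linarith

/-! ### Reducibility -/

lemma reduce_of_profile {ι : Type} [Countable ι] [Nonempty ι] {f g : ℝ → ℝ}
    (hf : ∀ t ∈ Icc (0:ℝ) 1, 0 ≤ f t) (hg : ∀ t ∈ Icc (0:ℝ) 1, 0 ≤ g t)
    (e : ι → Icc (0:ℝ) 1 → Icc (0:ℝ) 1) (he : ∀ i, Measurable (e i)) {M : ℝ} (hM : 1 ≤ M)
    (h : ∀ x y : Icc (0:ℝ) 1, Summable (fun i => g |(e i x : ℝ) - e i y|) ∧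
      f |(x:ℝ) - y| ≤ M * ∑' i, g |(e i x : ℝ) - e i y| ∧
      ∑' i, g |(e i x : ℝ) - e i y| ≤ M * f |(x:ℝ) - y|) :
    BorelReducible (EF f) (EF g) := by
  obtain ⟨p⟩ : Nonempty (ℕ ≃ ℕ × ι) := nonempty_equiv_of_countable
  refine ⟨fun x n => e (p n).2 (x (p n).1), ?_, fun x y => ?_⟩
  · refine measurable_pi_iff.2 fun n => (he _).comp (measurable_pi_apply _)
  · have hgn : ∀ i (a b : Icc (0:ℝ) 1), 0 ≤ g |(e i a : ℝ) - e i b| := fun i a b =>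
      hg _ (abs_sub_mem (Subtype.prop _) (Subtype.prop _))
    have h1 : EF g (fun n => e (p n).2 (x (p n).1)) (fun n => e (p n).2 (y (p n).1)) ↔
        Summable (fun q : ℕ × ι => g |(e q.2 (x q.1) : ℝ) - e q.2 (y q.1)|) :=
      Equiv.summable_iff (f := fun q : ℕ × ι => g |(e q.2 (x q.1) : ℝ) - e q.2 (y q.1)|) p
    have hnn : 0 ≤ (fun q : ℕ × ι => g |(e q.2 (x q.1) : ℝ) - e q.2 (y q.1)|) :=
      fun q => hgn _ _ _
    rw [h1, summable_prod_of_nonneg hnn]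
    constructor
    · intro hs
      refine ⟨fun m => (h (x m) (y m)).1, ?_⟩
      exact Summable.of_nonneg_of_le (fun m => tsum_nonneg fun i => hgn _ _ _)
        (fun m => (h (x m) (y m)).2.2) (hs.mul_left M)
    · rintro ⟨-, hs⟩
      exact Summable.of_nonneg_of_le
        (fun m => hf _ (abs_sub_mem (Subtype.prop _) (Subtype.prop _)))
        (fun m => (h (x m) (y m)).2.1) (hs.mul_left M)

lemma coeffs {α : ℝ} (hα : 1 ≤ α) {u v R : ℕ → ℝ} (hu : USeq u) (hv : USeq v) (hR0 : R 0 = 1)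
    (hgap : ∃ g : ℝ, 0 < g ∧ ∀ i, R (i+1) = R i ∨ R i + g ≤ R (i+1)) {B : ℝ}
    (h2 : ∀ n, v n * R n ≤ B * u n) :
    ∃ (b : ℕ → ℝ) (β γ : ℝ), 0 < β ∧ β ≤ 1 ∧ 0 < γ ∧ (∀ i, 0 ≤ b i) ∧
      (∀ n, ∑ i ∈ Finset.range (n+1), b i ^ α = γ * R n) ∧ (∀ i, b i = 0 ∨ β ≤ b i) ∧
      ∀ i, b i ^ 2 * (1/2:ℝ) ^ i ≤ 1 := by
  obtain ⟨g, hg, hgap⟩ := hgap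
  have hα0 : 0 < α := by linarith
  have hRm : Monotone R := monotone_nat_of_le_succ fun i => by
    rcases hgap i with h | h <;> linarith
  let q : ℕ → ℝ := fun i => if i = 0 then 1 else R i - R (i-1)
  have hq0 : ∀ i, 0 ≤ q i := by
    intro i
    by_cases h : i = 0
    · simp [q, h]
    · simp only [q, h, if_false]; linarith [hRm (Nat.sub_le i 1)]
  have hqs : ∀ n, ∑ i ∈ Finset.range (n+1), q i = R n := by
    intro n
    induction n with
    | zero => simp [q, hR0]
    | succ n ih => rw [Finset.sum_range_succ, ih]; simp [q]
  have hqgap : ∀ i, q i = 0 ∨ min g 1 ≤ q i := by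
    intro i
    rcases i with _ | i
    · right; simp [q]
    · rcases hgap i with h | h
      · left; simp [q, h]
      · right
        refine (min_le_left _ _).trans ?_
        simp only [q, Nat.add_sub_cancel, Nat.succ_ne_zero, if_false]; linarith
  let c : ℕ → ℝ := fun i => q i ^ (1/α)
  have hc0 : ∀ i, 0 ≤ c i := fun i => Real.rpow_nonneg (hq0 i) _
  have hcα : ∀ i, c i ^ α = q i := by
    intro i
    simp only [c]
    rw [← Real.rpow_mul (hq0 i), one_div_mul_cancel hα0.ne', Real.rpow_one]
  obtain ⟨p, hp⟩ := hv.poly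
  have hu1 : ∀ n, u n ≤ 1 := fun n => by rw [← hu.zero]; exact hu.anti (Nat.zero_le _)
  have hB0 : 0 < B := by
    have := h2 0
    rw [hv.zero, hu.zero, hR0] at this
    linarith
  have hRp : ∀ n, 0 < R n := fun n => by linarith [hRm (Nat.zero_le n)]
  have hRb : ∀ n : ℕ, R n ≤ B * ((n:ℝ) + 1) ^ p := by
    intro n
    have a1 := h2 n
    have a2 := hp n
    have a3 := hu1 n
    calc R n = 1 * R n := by ring
      _ ≤ (((n : ℝ) + 1) ^ p * v n) * R n := by have := (hRp n).le; gcongr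
      _ = ((n : ℝ) + 1) ^ p * (v n * R n) := by ring
      _ ≤ ((n : ℝ) + 1) ^ p * (B * u n) := by gcongr
      _ ≤ ((n : ℝ) + 1) ^ p * (B * 1) := by gcongr
      _ = _ := by ring
  have hqR : ∀ n, q n ≤ R n := by
    intro n
    rw [← hqs]
    exact Finset.single_le_sum (f := q) (fun i _ => hq0 i) (by simp)
  have hc2 : ∀ n : ℕ, c n ^ 2 ≤ 1 + (B * ((n:ℝ) + 1) ^ p) ^ 2 := by
    intro n
    rcases le_or_gt (c n) 1 with h | h
    · have : c n ^ 2 ≤ 1 := pow_le_one₀ (hc0 n) h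
      nlinarith [sq_nonneg (B * ((n:ℝ) + 1) ^ p)]
    · have h3 := Real.self_le_rpow_of_one_le h.le hα
      rw [hcα] at h3
      have h4 : c n ^ 2 ≤ (B * ((n:ℝ) + 1) ^ p) ^ 2 :=
        pow_le_pow_left₀ (hc0 n) (h3.trans ((hqR n).trans (hRb n))) 2
      linarith
  obtain ⟨n1, hn1⟩ := Filter.eventually_atTop.1 (poly_small (B^2) (p * 2))
  have hbd : ∃ K : ℝ, 1 ≤ K ∧ ∀ n : ℕ, c n ^ 2 * (1/2:ℝ) ^ n ≤ K := by
    refine ⟨2 + ∑ n ∈ Finset.range n1, c n ^ 2 * (1/2:ℝ) ^ n, ?_, fun n => ?_⟩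
    · have : 0 ≤ ∑ n ∈ Finset.range n1, c n ^ 2 * (1/2:ℝ) ^ n :=
        Finset.sum_nonneg fun i _ => by positivity
      linarith
    · rcases lt_or_ge n n1 with h | h
      · have := Finset.single_le_sum (f := fun n => c n ^ 2 * (1/2:ℝ) ^ n)
          (s := Finset.range n1) (fun i _ => by positivity) (Finset.mem_range.2 h)
        linarith
      · have a0 : 0 ≤ ∑ n ∈ Finset.range n1, c n ^ 2 * (1/2:ℝ) ^ n :=
          Finset.sum_nonneg fun i _ => by positivity
        have a1 := hn1 n h
        have a2 : c n ^ 2 * (1/2:ℝ) ^ n ≤ (1 + (B * ((n:ℝ) + 1) ^ p) ^ 2) * (1/2:ℝ) ^ n :=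
          mul_le_mul_of_nonneg_right (hc2 n) (by positivity)
        have a3 : (1 + (B * ((n:ℝ) + 1) ^ p) ^ 2) * (1/2:ℝ) ^ n = (1/2:ℝ) ^ n +
            B ^ 2 * ((n:ℝ) + 1) ^ (p * 2) * (1/2:ℝ) ^ n := by
          rw [pow_mul]; ring
        have a4 := (half_mem n).2
        linarith
  obtain ⟨K, hK1, hK⟩ := hbd
  have hK0 : 0 < K := by linarith
  have hKi : K⁻¹ ≤ 1 := inv_le_one_of_one_le₀ hK1
  have hKp : 0 < K⁻¹ := inv_pos.2 hK0
  have hm : 0 < min g 1 := lt_min hg one_pos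
  refine ⟨fun i => K⁻¹ * c i, K⁻¹ * (min g 1) ^ (1/α), (K⁻¹) ^ α, by positivity, ?_, by positivity,
    fun i => mul_nonneg hKp.le (hc0 i), fun n => ?_, fun i => ?_, fun i => ?_⟩
  · have : (min g 1) ^ (1/α) ≤ 1 := Real.rpow_le_one hm.le (min_le_right _ _) (by positivity)
    exact mul_le_one₀ hKi (by positivity) this
  · rw [← hqs, Finset.mul_sum]
    refine Finset.sum_congr rfl fun i _ => ?_
    rw [Real.mul_rpow hKp.le (hc0 i), hcα]
  · rcases hqgap i with h | h
    · left
      simp only [c, h]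
      rw [Real.zero_rpow (by positivity), mul_zero]
    · right
      refine mul_le_mul_of_nonneg_left ?_ hKp.le
      exact Real.rpow_le_rpow hm.le h (by positivity)
  · calc (K⁻¹ * c i) ^ 2 * (1/2:ℝ) ^ i = K⁻¹ * (K⁻¹ * (c i ^ 2 * (1/2:ℝ) ^ i)) := by ring
      _ ≤ K⁻¹ * (K⁻¹ * K) := by gcongr; exact hK i
      _ = K⁻¹ := by rw [inv_mul_cancel₀ hK0.ne', mul_one]
      _ ≤ 1 := hKi

noncomputable def trig (b : Bool) (x : ℝ) : ℝ := if b then Real.sin x else Real.cos x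

lemma trig_cont (b : Bool) : Continuous (trig b) := by
  unfold trig
  cases b
  · simp only [Bool.false_eq_true, if_false]; exact Real.continuous_cos
  · simp only [if_true]; exact Real.continuous_sin

lemma trig_lip (b : Bool) (x y : ℝ) : |trig b x - trig b y| ≤ |x - y| := by
  cases b
  · simpa [trig, Real.dist_eq] using Real.lipschitzWith_cos.dist_le_mul x y
  · simpa [trig] using Real.abs_sin_sub_sin_le x y

lemma trig_abs (b : Bool) (x : ℝ) : -1 ≤ trig b x ∧ trig b x ≤ 1 := by
  cases b
  · simpa [trig] using ⟨Real.neg_one_le_cos x, Real.cos_le_one x⟩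
  · simpa [trig] using ⟨Real.neg_one_le_sin x, Real.sin_le_one x⟩

lemma trig_lower {x y : ℝ} (h : |x - y| ≤ 1) : ∃ b, |x - y| / 3 ≤ |trig b x - trig b y| := by
  by_contra hcon
  push Not at hcon
  have h1 := hcon true
  have h2 := hcon false
  simp only [trig, if_true, Bool.false_eq_true, if_false] at h1 h2
  have h3 : Real.cos (x - y) ≤ 1 - 2 / Real.pi ^ 2 * (x - y) ^ 2 :=
    Real.cos_le_one_sub_mul_cos_sq (h.trans (by linarith [Real.pi_gt_three]))
  have h4 : (1:ℝ)/8 ≤ 2 / Real.pi ^ 2 := by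
    rw [div_le_div_iff₀ (by norm_num) (by positivity)]
    nlinarith [Real.pi_lt_four, Real.pi_pos]
  have h5 : (Real.sin x - Real.sin y) ^ 2 < (|x - y| / 3) ^ 2 := by
    rw [← sq_abs]; exact pow_lt_pow_left₀ h1 (abs_nonneg _) (by norm_num)
  have h6 : (Real.cos x - Real.cos y) ^ 2 < (|x - y| / 3) ^ 2 := by
    rw [← sq_abs]; exact pow_lt_pow_left₀ h2 (abs_nonneg _) (by norm_num)
  have h7 : (|x - y| / 3) ^ 2 = (x - y) ^ 2 / 9 := by rw [div_pow, sq_abs]; norm_num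
  rw [Real.cos_sub] at h3
  rw [h7] at h5 h6
  have h8 := Real.sin_sq_add_cos_sq x
  have h9 := Real.sin_sq_add_cos_sq y
  have h10 : 1/8 * (x - y)^2 ≤ 2 / Real.pi ^ 2 * (x - y) ^ 2 :=
    mul_le_mul_of_nonneg_right h4 (sq_nonneg _)
  nlinarith [sq_nonneg (x - y)]

noncomputable def emb (w : ℕ → ℝ) (q : ℕ × Bool) (x : ℝ) : ℝ :=
  w q.1 * (1/2:ℝ) ^ q.1 * ((1 + trig q.2 (2 ^ q.1 * x)) / 2)

lemma emb_mem {w : ℕ → ℝ} (hw0 : ∀ i, 0 ≤ w i) (hw2 : ∀ i, w i ^ 2 * (1/2:ℝ) ^ i ≤ 1)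
    (q : ℕ × Bool) (x : ℝ) : emb w q x ∈ Icc (0:ℝ) 1 := by
  have h := trig_abs q.2 (2 ^ q.1 * x)
  have h0 := hw0 q.1
  have hh := half_mem q.1
  have h1 : w q.1 * (1/2:ℝ) ^ q.1 ≤ 1 := by
    have : (w q.1 * (1/2:ℝ) ^ q.1) ^ 2 ≤ 1 := by
      calc (w q.1 * (1/2:ℝ) ^ q.1) ^ 2 = (w q.1 ^ 2 * (1/2:ℝ) ^ q.1) * (1/2:ℝ) ^ q.1 := by ring
        _ ≤ 1 * 1 := mul_le_mul (hw2 _) hh.2 hh.1 (by norm_num)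
        _ = 1 := by norm_num
    exact (sq_le_one_iff₀ (by positivity)).1 this
  refine ⟨mul_nonneg (by positivity) (by linarith), ?_⟩
  exact mul_le_one₀ h1 (by linarith) (by linarith)

lemma emb_sub (w : ℕ → ℝ) (hw0 : ∀ i, 0 ≤ w i) (q : ℕ × Bool) (x y : ℝ) :
    |emb w q x - emb w q y| =
      w q.1 * (1/2:ℝ) ^ q.1 * (|trig q.2 (2 ^ q.1 * x) - trig q.2 (2 ^ q.1 * y)| / 2) := by
  have h0 := hw0 q.1
  have : emb w q x - emb w q y =
      w q.1 * (1/2:ℝ) ^ q.1 * ((trig q.2 (2 ^ q.1 * x) - trig q.2 (2 ^ q.1 * y)) / 2) := by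
    unfold emb; ring
  rw [this, abs_mul, abs_of_nonneg (by positivity), abs_div]; norm_num

lemma arg_sub (i : ℕ) (x y : ℝ) : |(2:ℝ) ^ i * x - 2 ^ i * y| = 2 ^ i * |x - y| := by
  rw [← mul_sub, abs_mul, abs_of_pos (by positivity)]

lemma emb_upper1 {w : ℕ → ℝ} (hw0 : ∀ i, 0 ≤ w i) (q : ℕ × Bool) (x y : ℝ) :
    |emb w q x - emb w q y| ≤ w q.1 * |x - y| := by
  rw [emb_sub w hw0]
  have h := trig_lip q.2 (2 ^ q.1 * x) (2 ^ q.1 * y)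
  rw [arg_sub] at h
  have h0 := hw0 q.1
  have h1 : (1/2:ℝ) ^ q.1 * 2 ^ q.1 = 1 := by rw [← mul_pow]; norm_num
  calc _ ≤ w q.1 * (1/2:ℝ) ^ q.1 * (2 ^ q.1 * |x - y|) := by
        have := abs_nonneg (trig q.2 (2 ^ q.1 * x) - trig q.2 (2 ^ q.1 * y))
        gcongr; linarith
    _ = w q.1 * ((1/2:ℝ) ^ q.1 * 2 ^ q.1) * |x - y| := by ring
    _ = _ := by rw [h1, mul_one]

lemma emb_upper2 {w : ℕ → ℝ} (hw0 : ∀ i, 0 ≤ w i) (q : ℕ × Bool) (x y : ℝ) :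
    |emb w q x - emb w q y| ≤ w q.1 * (1/2:ℝ) ^ q.1 := by
  rw [emb_sub w hw0]
  have h1 := trig_abs q.2 (2 ^ q.1 * x)
  have h2 := trig_abs q.2 (2 ^ q.1 * y)
  have h0 := hw0 q.1
  refine mul_le_of_le_one_right (by positivity) ?_
  have : |trig q.2 (2 ^ q.1 * x) - trig q.2 (2 ^ q.1 * y)| ≤ 2 := abs_le.2 ⟨by linarith, by linarith⟩
  linarith

lemma emb_lower {w : ℕ → ℝ} (hw0 : ∀ i, 0 ≤ w i) (i : ℕ) (x y : ℝ) (h : 2 ^ i * |x - y| ≤ 1) :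
    ∃ b, w i * |x - y| / 6 ≤ |emb w (i, b) x - emb w (i, b) y| := by
  rw [← arg_sub] at h
  obtain ⟨b, hb⟩ := trig_lower h
  refine ⟨b, ?_⟩
  rw [emb_sub w hw0]
  rw [arg_sub] at hb
  have h0 := hw0 i
  have h1 : (1/2:ℝ) ^ i * 2 ^ i = 1 := by rw [← mul_pow]; norm_num
  calc w i * |x - y| / 6 = w i * ((1/2:ℝ) ^ i * 2 ^ i) * |x - y| / 6 := by rw [h1, mul_one]
    _ = w i * (1/2:ℝ) ^ i * ((2 ^ i * |x - y| / 3) / 2) := by ring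
    _ ≤ _ := by gcongr

lemma part2 {α : ℝ} (hα : 1 ≤ α) {φ ωU ωV : ℝ → ℝ} {u v R : ℕ → ℝ} (hu : USeq u) (hv : USeq v)
    (hφei : EssIncOn φ (Icc 0 1)) (hφpos : ∀ t ∈ Ioc (0:ℝ) 1, 0 < φ t)
    (hvalU : ∀ n : ℕ, ωU ((1/2:ℝ)^n) = u n) (hvalV : ∀ n : ℕ, ωV ((1/2:ℝ)^n) = v n)
    (hU : Slow (fun t => φ t * ωU t)) (hV : Slow (fun t => φ t * ωV t))
    (hR0 : R 0 = 1)
    (hgap : ∃ g : ℝ, 0 < g ∧ ∀ i, R (i+1) = R i ∨ R i + g ≤ R (i+1)) {B b0 : ℝ} (hb0 : 0 < b0)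
    (h1 : ∀ n, b0 * u n ≤ v n * R n) (h2 : ∀ n, v n * R n ≤ B * u n) :
    BorelReducible (EF (Fn α (fun t => φ t * ωU t))) (EF (Fn α (fun t => φ t * ωV t))) := by
  set ψU := fun t => φ t * ωU t with hψU
  set ψV := fun t => φ t * ωV t with hψV
  obtain ⟨w, β, γ, hβ, hβ1, hγ, hw0, hws, hwβ, hw2⟩ := coeffs hα hu hv hR0 hgap h2
  obtain ⟨A, hA, hφ⟩ := hφei
  obtain ⟨Cs, hCs, hs⟩ := hV.slow
  obtain ⟨Ce, hCe, hge⟩ := Fn_ei hα hV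
  obtain ⟨Cu, hCu, hfe⟩ := Fn_ei hα hU
  obtain ⟨Ch, hCh, hfh⟩ := Fn_half hα hU (1/2) (by norm_num) (by norm_num)
  obtain ⟨Cσ, hCσ, hσ⟩ := hV.scale (β/12) (by positivity) (by linarith)
  have hB0 : 0 < B := by
    have a1 := h2 0
    rw [hv.zero, hu.zero, hR0] at a1
    linarith
  have hφh : ∀ n : ℕ, 0 < φ ((1/2:ℝ)^n) := fun n => hφpos _ ⟨by positivity, (half_mem n).2⟩
  have hfU : ∀ n : ℕ, Fn α ψU ((1/2:ℝ)^n) = ((1/2:ℝ)^n) ^ α * φ ((1/2:ℝ)^n) * u n := by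
    intro n; simp only [Fn, hψU, hvalU]; ring
  have hψVh : ∀ n : ℕ, ψV ((1/2:ℝ)^n) = φ ((1/2:ℝ)^n) * v n := by
    intro n; simp only [hψV, hvalV]
  have hwα : ∀ i, 0 ≤ w i ^ α := fun i => Real.rpow_nonneg (hw0 i) _
  -- bound at a scale
  have hscale : ∀ i n, i ≤ n → ∀ z, 0 ≤ z → z ≤ w i * (1/2:ℝ)^n →
      Fn α ψV z ≤ Ce * Cs * (w i ^ α * (((1/2:ℝ)^n) ^ α * (φ ((1/2:ℝ)^n) * v n))) := by
    intro i n hin z hz hzw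
    set y := w i * (1/2:ℝ)^n with hy
    have hy2 : y ^ 2 ≤ (1/2:ℝ)^n := by
      calc y ^ 2 = (w i ^ 2 * (1/2:ℝ)^n) * (1/2:ℝ)^n := by rw [hy]; ring
        _ ≤ (w i ^ 2 * (1/2:ℝ)^i) * (1/2:ℝ)^n := by
            have := pow_le_pow_of_le_one (a := (1/2:ℝ)) (by norm_num) (by norm_num) hin
            gcongr
        _ ≤ 1 * (1/2:ℝ)^n := by gcongr; exact hw2 i
        _ = _ := one_mul _
    have hy0 : 0 ≤ y := hz.trans hzw
    have hy1 : y ≤ 1 := (sq_le_one_iff₀ hy0).1 (hy2.trans (half_mem n).2)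
    have a1 := hge z y hz hzw hy1
    have a2 := hs y ⟨hy0, hy1⟩ _ (half_mem n) hy2
    rw [hψVh] at a2
    calc Fn α ψV z ≤ Ce * Fn α ψV y := a1
      _ = Ce * (y ^ α * ψV y) := rfl
      _ ≤ Ce * (y ^ α * (Cs * (φ ((1/2:ℝ)^n) * v n))) := by
          have := Real.rpow_nonneg hy0 α
          gcongr
      _ = _ := by rw [hy, Real.mul_rpow (hw0 i) (by positivity)]; ring
  -- tail terms
  have htail : ∀ n j, ∀ z, 0 ≤ z → z ≤ w (n+1+j) * (1/2:ℝ)^(n+1+j) →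
      Fn α ψV z ≤ (Ce * Cs * γ * B * A) * Fn α ψU ((1/2:ℝ)^n) * (1/2:ℝ)^j := by
    intro n j z hz hzw
    set i := n + 1 + j with hi
    have a1 := hscale i i le_rfl z hz hzw
    have a2 : w i ^ α ≤ γ * R i := by
      rw [← hws]
      exact Finset.single_le_sum (f := fun i => w i ^ α) (fun i _ => hwα i) (by simp)
    have a3 : w i ^ α * v i ≤ γ * (B * u n) := by
      calc w i ^ α * v i ≤ (γ * R i) * v i := by have := (hv.pos i).le; gcongr
        _ = γ * (v i * R i) := by ring
        _ ≤ γ * (B * u i) := by have := h2 i; gcongr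
        _ ≤ γ * (B * u n) := by
            have := hu.anti (show n ≤ i by omega)
            gcongr
    have a4 : φ ((1/2:ℝ)^i) ≤ A * φ ((1/2:ℝ)^n) := hφ _ (half_mem _) _ (half_mem _)
      (pow_le_pow_of_le_one (by norm_num) (by norm_num) (by omega))
    have a5 : ((1/2:ℝ)^i) ^ α ≤ ((1/2:ℝ)^n) ^ α * (1/2:ℝ)^j := by
      rw [show (1/2:ℝ)^i = (1/2:ℝ)^n * (1/2:ℝ)^(1+j) by rw [← pow_add]; congr 1; omega,
        Real.mul_rpow (by positivity) (by positivity)]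
      refine mul_le_mul_of_nonneg_left ?_ (by positivity)
      calc ((1/2:ℝ)^(1+j)) ^ α ≤ ((1/2:ℝ)^(1+j)) ^ (1:ℝ) :=
            Real.rpow_le_rpow_of_exponent_ge (by positivity) (half_mem _).2 hα
        _ = (1/2:ℝ)^(1+j) := Real.rpow_one _
        _ ≤ (1/2:ℝ)^j := pow_le_pow_of_le_one (by norm_num) (by norm_num) (by omega)
    have c1 := hwα i
    have c2 := (hv.pos i).le
    have c3 := (hφh i).le
    have c4 := (hφh n).le
    have c5 := (hu.pos n).le
    calc Fn α ψV z ≤ _ := a1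
      _ = Ce * Cs * (((1/2:ℝ)^i) ^ α * φ ((1/2:ℝ)^i) * (w i ^ α * v i)) := by ring
      _ ≤ Ce * Cs * ((((1/2:ℝ)^n) ^ α * (1/2:ℝ)^j) * (A * φ ((1/2:ℝ)^n)) * (γ * (B * u n))) := by
          refine mul_le_mul_of_nonneg_left ?_ (by positivity)
          refine mul_le_mul ?_ a3 (by positivity) (by positivity)
          exact mul_le_mul a5 a4 c3 (by positivity)
      _ = _ := by rw [hfU]; ring
  set e : ℕ × Bool → Icc (0:ℝ) 1 → Icc (0:ℝ) 1 := fun q x => ⟨emb w q x, emb_mem hw0 hw2 q x⟩ with he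
  set M1 : ℝ := 2 * (Ce * Cs * γ * B) + 4 * (Ce * Cs * γ * B * A) with hM1
  have hM1p : 0 < M1 := by positivity
  set M2 : ℝ := Cu * (12 ^ α * Cσ * (b0 * γ)⁻¹) with hM2
  have hM2p : 0 < M2 := by positivity
  refine reduce_of_profile (Fn_nn hU) (Fn_nn hV) e (fun q => ?_)
    (M := max 1 (max (M1 * Ch) M2)) (le_max_left _ _) fun x y => ?_
  · refine Measurable.subtype_mk ?_
    have hc : Continuous (emb w q) := by
      unfold emb
      have := trig_cont q.2
      fun_prop
    exact hc.measurable.comp measurable_subtype_coe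
  set D := |(x:ℝ) - y| with hD
  have hDm : D ∈ Icc (0:ℝ) 1 := abs_sub_mem x.2 y.2
  set F : ℕ × Bool → ℝ := fun q => Fn α ψV |(e q x : ℝ) - e q y| with hF
  have hFnn : 0 ≤ F := fun q => Fn_nn hV _ (abs_sub_mem (Subtype.prop _) (Subtype.prop _))
  rcases hDm.1.eq_or_lt with hD0 | hD0
  · have hxy : x = y := by
      have := abs_eq_zero.1 hD0.symm
      exact Subtype.ext (by linarith)
    have hF0 : F = fun _ => 0 := by
      funext q; simp [hF, hxy, Fn_zero hα]
    rw [hF0, ← hD0, Fn_zero hα]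
    simp [summable_zero]
  obtain ⟨n, hn1, hn2⟩ := exists_dyadic hD0 hDm.2
  set H : ℕ → ℝ := fun i => F (i, false) + F (i, true) with hH
  have hHnn : ∀ i, 0 ≤ H i := fun i => add_nonneg (hFnn _) (hFnn _)
  have hfn0 : 0 ≤ Fn α ψU ((1/2:ℝ)^n) := Fn_nn hU _ (half_mem _)
  have hFup : ∀ q : ℕ × Bool, q.1 ≤ n →
      F q ≤ Ce * Cs * (w q.1 ^ α * (((1/2:ℝ)^n) ^ α * (φ ((1/2:ℝ)^n) * v n))) := by
    intro q hq
    refine hscale q.1 n hq _ (abs_nonneg _) ((emb_upper1 hw0 q x y).trans ?_)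
    exact mul_le_mul_of_nonneg_left hn2 (hw0 _)
  have hhead : ∑ i ∈ Finset.range (n+1), H i ≤ 2 * (Ce * Cs * γ * B) * Fn α ψU ((1/2:ℝ)^n) := by
    have c4 := (hφh n).le
    calc ∑ i ∈ Finset.range (n+1), H i ≤ ∑ i ∈ Finset.range (n+1),
          w i ^ α * (2 * (Ce * Cs * (((1/2:ℝ)^n) ^ α * (φ ((1/2:ℝ)^n) * v n)))) := by
          refine Finset.sum_le_sum fun i hi => ?_
          have hin : i ≤ n := Nat.lt_succ_iff.1 (Finset.mem_range.1 hi)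
          have b1 := hFup (i, false) hin
          have b2 := hFup (i, true) hin
          simp only at b1 b2
          simp only [hH]
          linarith
      _ = (v n * R n) * (2 * (Ce * Cs * γ) * (((1/2:ℝ)^n) ^ α * φ ((1/2:ℝ)^n))) := by
          rw [← Finset.sum_mul, hws]; ring
      _ ≤ (B * u n) * (2 * (Ce * Cs * γ) * (((1/2:ℝ)^n) ^ α * φ ((1/2:ℝ)^n))) :=
          mul_le_mul_of_nonneg_right (h2 n) (by positivity)
      _ = _ := by rw [hfU]; ring
  have hsum : ∀ m, ∑ i ∈ Finset.range m, H i ≤ M1 * Fn α ψU ((1/2:ℝ)^n) := by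
    intro m
    calc ∑ i ∈ Finset.range m, H i ≤ ∑ i ∈ Finset.range (n + 1 + m), H i :=
          Finset.sum_le_sum_of_subset_of_nonneg (Finset.range_mono (by omega))
            fun i _ _ => hHnn i
      _ = ∑ i ∈ Finset.range (n+1), H i + ∑ j ∈ Finset.range m, H (n+1+j) :=
          Finset.sum_range_add _ _ _
      _ ≤ 2 * (Ce * Cs * γ * B) * Fn α ψU ((1/2:ℝ)^n) + ∑ j ∈ Finset.range m,
            (2 * (Ce * Cs * γ * B * A) * Fn α ψU ((1/2:ℝ)^n)) * (1/2:ℝ)^j := by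
          refine add_le_add hhead (Finset.sum_le_sum fun j _ => ?_)
          have b1 := htail n j _ (abs_nonneg _) (emb_upper2 hw0 (n+1+j, false) x y)
          have b2 := htail n j _ (abs_nonneg _) (emb_upper2 hw0 (n+1+j, true) x y)
          simp only [hH, hF, he]
          linarith
      _ ≤ 2 * (Ce * Cs * γ * B) * Fn α ψU ((1/2:ℝ)^n) +
            (2 * (Ce * Cs * γ * B * A) * Fn α ψU ((1/2:ℝ)^n)) * 2 := by
          rw [← Finset.mul_sum]
          have := sum_geometric_two_le m
          gcongr
      _ = _ := by rw [hM1]; ring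
  have hHs : Summable H := summable_of_sum_range_le hHnn hsum
  have hfib : ∀ i, Summable fun b => F (i, b) := fun i => Summable.of_finite
  have htb : (fun i => ∑' b, F (i, b)) = H := by
    funext i; rw [tsum_bool]
  have hFs : Summable F := by
    rw [summable_prod_of_nonneg hFnn, htb]
    exact ⟨hfib, hHs⟩
  have hFt : ∑' q, F q = ∑' i, H i := by
    rw [hFs.tsum_prod' hfib, ← htb]
  have hHt : 0 ≤ ∑' i, H i := tsum_nonneg hHnn
  refine ⟨hFs, ?_, ?_⟩
  · -- lower
    rw [hFt]
    have hlow : ∀ i ∈ Finset.range (n+1), w i ^ α * (((1/2:ℝ)^n) ^ α * (φ ((1/2:ℝ)^n) * v n)) ≤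
        12 ^ α * Cσ * H i := by
      intro i hi
      have hin : i ≤ n := Nat.lt_succ_iff.1 (Finset.mem_range.1 hi)
      rcases hwβ i with h | h
      · rw [h, Real.zero_rpow (by linarith), zero_mul]
        exact mul_nonneg (by positivity) (hHnn i)
      · obtain ⟨b, hb⟩ := emb_lower hw0 i x y (by
          have e1 : (2:ℝ) ^ n * (1/2:ℝ) ^ n = 1 := by rw [← mul_pow]; norm_num
          calc (2:ℝ) ^ i * D ≤ 2 ^ n * (1/2:ℝ) ^ n :=
                mul_le_mul (pow_le_pow_right₀ (by norm_num) hin) hn2 hDm.1 (by positivity)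
            _ = 1 := e1)
        set z := |emb w (i, b) x - emb w (i, b) y| with hz
        have hzm : z ∈ Icc (0:ℝ) 1 := abs_sub_mem (emb_mem hw0 hw2 _ _) (emb_mem hw0 hw2 _ _)
        have hz1 : w i * (1/2:ℝ)^n / 12 ≤ z := by
          refine le_trans ?_ hb
          rw [pow_succ] at hn1
          have := mul_le_mul_of_nonneg_left hn1.le (hw0 i)
          linarith
        have hz2 : β / 12 * (1/2:ℝ)^n ≤ z := by
          refine le_trans ?_ hz1
          have := mul_le_mul_of_nonneg_right h (half_mem n).1
          linarith
        have hz3 := hσ _ (half_mem n) z hzm hz2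
        rw [hψVh] at hz3
        have hz4 : w i ^ α * ((1/2:ℝ)^n) ^ α ≤ 12 ^ α * z ^ α := by
          rw [← Real.mul_rpow (hw0 i) (by positivity), ← Real.mul_rpow (by norm_num) hzm.1]
          refine Real.rpow_le_rpow (mul_nonneg (hw0 i) (by positivity)) ?_ (by linarith)
          linarith
        have hFH : F (i, b) ≤ H i := by
          have := hFnn (i, false)
          have := hFnn (i, true)
          simp only [Pi.zero_apply] at *
          cases b <;> simp only [hH] <;> linarith
        have c4 := (hφh n).le
        have c5 := (hv.pos n).le
        calc w i ^ α * (((1/2:ℝ)^n) ^ α * (φ ((1/2:ℝ)^n) * v n))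
            = (w i ^ α * ((1/2:ℝ)^n) ^ α) * (φ ((1/2:ℝ)^n) * v n) := by ring
          _ ≤ (12 ^ α * z ^ α) * (Cσ * ψV z) :=
              mul_le_mul hz4 hz3 (by positivity)
                (mul_nonneg (by positivity) (Real.rpow_nonneg hzm.1 _))
          _ = 12 ^ α * Cσ * F (i, b) := by simp only [hF, Fn, he]; ring
          _ ≤ _ := by gcongr
    have hl2 : (b0 * γ) * Fn α ψU ((1/2:ℝ)^n) ≤ 12 ^ α * Cσ * ∑' i, H i := by
      have c4 := (hφh n).le
      calc (b0 * γ) * Fn α ψU ((1/2:ℝ)^n)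
          = (b0 * u n) * (γ * (((1/2:ℝ)^n) ^ α * φ ((1/2:ℝ)^n))) := by rw [hfU]; ring
        _ ≤ (v n * R n) * (γ * (((1/2:ℝ)^n) ^ α * φ ((1/2:ℝ)^n))) :=
            mul_le_mul_of_nonneg_right (h1 n) (by positivity)
        _ = ∑ i ∈ Finset.range (n+1), w i ^ α * (((1/2:ℝ)^n) ^ α * (φ ((1/2:ℝ)^n) * v n)) := by
            rw [← Finset.sum_mul, hws]; ring
        _ ≤ ∑ i ∈ Finset.range (n+1), 12 ^ α * Cσ * H i := Finset.sum_le_sum hlow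
        _ = 12 ^ α * Cσ * ∑ i ∈ Finset.range (n+1), H i := by rw [Finset.mul_sum]
        _ ≤ _ := by
            refine mul_le_mul_of_nonneg_left ?_ (by positivity)
            exact hHs.sum_le_tsum _ fun i _ => hHnn i
    have hl3 : Fn α ψU D ≤ Cu * Fn α ψU ((1/2:ℝ)^n) := hfe _ _ hDm.1 hn2 (half_mem n).2
    have hbγ : 0 < b0 * γ := by positivity
    calc Fn α ψU D ≤ Cu * Fn α ψU ((1/2:ℝ)^n) := hl3
      _ = Cu * ((b0 * γ)⁻¹ * ((b0 * γ) * Fn α ψU ((1/2:ℝ)^n))) := by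
          rw [inv_mul_cancel_left₀ hbγ.ne']
      _ ≤ Cu * ((b0 * γ)⁻¹ * (12 ^ α * Cσ * ∑' i, H i)) := by gcongr
      _ = M2 * ∑' i, H i := by rw [hM2]; ring
      _ ≤ _ := mul_le_mul_of_nonneg_right ((le_max_right _ _).trans (le_max_right _ _)) hHt
  · rw [hFt]
    have hup := Real.tsum_le_of_sum_range_le hHnn hsum
    have hup2 : Fn α ψU ((1/2:ℝ)^n) ≤ Ch * Fn α ψU D := by
      refine hfh _ (half_mem n) D hDm ?_
      rw [pow_succ] at hn1
      linarith
    calc ∑' i, H i ≤ M1 * Fn α ψU ((1/2:ℝ)^n) := hup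
      _ ≤ M1 * (Ch * Fn α ψU D) := by gcongr
      _ = (M1 * Ch) * Fn α ψU D := by ring
      _ ≤ _ := mul_le_mul_of_nonneg_right ((le_max_left _ _).trans (le_max_right _ _))
          (Fn_nn hU _ hDm)

/-! ### The concrete data -/

def blk (a : ℕ → ℕ) (U : Set ℕ) : Set ℕ := {m | ∃ l ∈ U, a l ≤ m ∧ m < a (l+1)}

open Classical in
noncomputable def rho (a : ℕ → ℕ) (δs : ℕ → ℝ) (U : Set ℕ) (m : ℕ) : ℝ :=
  if m ∈ blk a U then δs m else 1

lemma u_eq {a k c : ℕ → ℕ} {δs : ℕ → ℝ} (hk : StrictMono k) (hk0 : 2 ≤ k 0)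
    (hc : ∀ m n, m < c n ↔ k m ≤ n) {U : Set ℕ}
    {u : ℕ → ℝ} (hu0 : u 0 = 1)
    (huk : ∀ (n m l : ℕ), n + 1 = k m → a l ≤ m → m < a (l+1) → l ∈ U →
      u (n+1) = δs m * u n)
    (hunk : ∀ (n : ℕ),
      (¬ ∃ m l, n + 1 = k m ∧ a l ≤ m ∧ m < a (l+1) ∧ l ∈ U) → u (n+1) = u n) :
    u = fun n => ∏ j ∈ Finset.range (c n), rho a δs U j := by
  funext n
  induction n with
  | zero => simp [count_zero hc hk0, hu0]
  | succ n ih =>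
    by_cases h : ∃ m, n + 1 = k m
    · obtain ⟨m, hm⟩ := h
      obtain ⟨h1, h2⟩ := count_succ_of hc hk hm
      rw [h2, Finset.prod_range_succ]
      rw [h1] at ih
      by_cases hb : m ∈ blk a U
      · obtain ⟨l, hl, h3, h4⟩ := id hb
        rw [huk n m l hm h3 h4 hl, ih, rho, if_pos hb, mul_comm]
      · rw [rho, if_neg hb, mul_one, ← ih]
        refine hunk n ?_
        rintro ⟨m', l, h3, h4, h5, h6⟩
        have : m = m' := hk.injective (hm.symm.trans h3)
        subst this
        exact hb ⟨l, h6, h4, h5⟩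
    · push Not at h
      rw [count_succ_of_not hc h, ← ih]
      refine hunk n ?_
      rintro ⟨m', l, h3, -⟩
      exact h m' h3

lemma a_mono {a : ℕ → ℕ} (haS : ∀ l, a (l+1) = a l + 1 + l * a l) : StrictMono a :=
  strictMono_nat_of_lt_succ fun l => by
    rw [haS]
    have := Nat.zero_le (l * a l)
    omega

lemma blk_unique {a : ℕ → ℕ} (ha : StrictMono a) {l l' m : ℕ} (h1 : a l ≤ m) (h2 : m < a (l+1))
    (h3 : a l' ≤ m) (h4 : m < a (l'+1)) : l = l' := by
  have e1 : l < l' + 1 := ha.lt_iff_lt.1 (h1.trans_lt h4)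
  have e2 : l' < l + 1 := ha.lt_iff_lt.1 (h3.trans_lt h2)
  omega

lemma count_k {k c : ℕ → ℕ} (hk : StrictMono k) (hc : ∀ m n, m < c n ↔ k m ≤ n) (m : ℕ) :
    c (k m) = m + 1 := by
  refine eq_of_forall_lt_iff fun j => ?_
  rw [hc, hk.le_iff_le, Nat.lt_succ_iff]

lemma sep {a k c : ℕ → ℕ} {δs : ℕ → ℝ} (haS : ∀ l, a (l+1) = a l + 1 + l * a l)
    (hk : StrictMono k) (hc : ∀ m n, m < c n ↔ k m ≤ n) {s : ℝ} (hs1 : s < 1)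
    (hδ0 : ∀ m, 0 < δs m) (hδ : ∀ m, δs m ≤ s) {U V : Set ℕ} (hUV : (U \ V).Infinite)
    (B : ℝ) (n1 : ℕ) : ∃ n0 n, n1 ≤ n0 ∧ n0 ≤ n ∧
      ∏ j ∈ Finset.range (c n0), rho a δs V j = ∏ j ∈ Finset.range (c n), rho a δs V j ∧
      B * ∏ j ∈ Finset.range (c n), rho a δs U j < ∏ j ∈ Finset.range (c n0), rho a δs U j := by
  have ha := a_mono haS
  have hs0 : 0 < s := (hδ0 0).trans_le (hδ 0)
  have hlim : Filter.Tendsto (fun l : ℕ => |B| * s ^ l) Filter.atTop (nhds 0) := by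
    simpa using (tendsto_pow_atTop_nhds_zero_of_lt_one hs0.le hs1).const_mul |B|
  obtain ⟨L, hL⟩ := Filter.eventually_atTop.1 (hlim.eventually (gt_mem_nhds one_pos))
  obtain ⟨l, hl, hlL⟩ := hUV.exists_gt (max n1 (max L 1))
  have hln : n1 ≤ l := (le_max_left _ _).trans hlL.le
  have hlL2 : L ≤ l := ((le_max_left _ _).trans (le_max_right _ _)).trans hlL.le
  have hl1 : 1 ≤ l := ((le_max_right _ _).trans (le_max_right _ _)).trans hlL.le
  have hal : l ≤ a l := ha.id_le l
  have hb : ∀ x ∈ Finset.range (l * a l), a l ≤ a l + 1 + x ∧ a l + 1 + x < a (l+1) := by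
    intro x hx
    rw [haS]
    have := Finset.mem_range.1 hx
    omega
  refine ⟨k (a l), k (a l + l * a l), hln.trans (hal.trans (hk.id_le _)),
    hk.monotone (by omega), ?_, ?_⟩
  · rw [count_k hk hc, count_k hk hc, show a l + l * a l + 1 = a l + 1 + l * a l by ring,
      Finset.prod_range_add _ (a l + 1) (l * a l), Finset.prod_eq_one (s := Finset.range (l * a l)), mul_one]
    intro x hx
    rw [rho, if_neg]
    rintro ⟨l', hl', h1, h2⟩
    have := blk_unique ha (hb x hx).1 (hb x hx).2 h1 h2
    exact hl.2 (this ▸ hl')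
  · rw [count_k hk hc, count_k hk hc, show a l + l * a l + 1 = a l + 1 + l * a l by ring,
      Finset.prod_range_add]
    have hpos : ∀ j, 0 < rho a δs U j := by
      intro j; unfold rho; split_ifs
      · exact hδ0 j
      · exact one_pos
    set P := ∏ j ∈ Finset.range (a l + 1), rho a δs U j with hP
    have hP0 : 0 < P := Finset.prod_pos fun j _ => hpos j
    set T := ∏ x ∈ Finset.range (l * a l), rho a δs U (a l + 1 + x) with hT
    have hT0 : 0 < T := Finset.prod_pos fun j _ => hpos _
    have hT1 : T ≤ s ^ l := by
      have h1 : T ≤ ∏ x ∈ Finset.range (l * a l), s := by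
        refine Finset.prod_le_prod (fun j _ => (hpos _).le) fun x hx => ?_
        rw [rho, if_pos ⟨l, hl.1, hb x hx⟩]
        exact hδ _
      rw [Finset.prod_const, Finset.card_range] at h1
      refine h1.trans (pow_le_pow_of_le_one hs0.le hs1.le ?_)
      exact Nat.le_mul_of_pos_right l (by omega)
    have h3 : |B| * T < 1 := lt_of_le_of_lt (by gcongr) (hL l hlL2)
    calc B * (P * T) ≤ |B| * (P * T) := by
          have := le_abs_self B
          gcongr
      _ = (|B| * T) * P := by ring
      _ < 1 * P := by gcongr
      _ = P := one_mul P

lemma ratio {a k c : ℕ → ℕ} {δs : ℕ → ℝ} (hk : StrictMono k)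
    (hk0 : 2 ≤ k 0) (hc : ∀ m n, m < c n ↔ k m ≤ n) {s : ℝ} (hs1 : s < 1)
    (hδ0 : ∀ m, 0 < δs m) (hδ : ∀ m, δs m ≤ s) {U V : Set ℕ} (hUV : (U \ V).Finite) :
    ∃ (R : ℕ → ℝ) (B : ℝ), R 0 = 1 ∧ (∃ g : ℝ, 0 < g ∧ ∀ i, R (i+1) = R i ∨ R i + g ≤ R (i+1)) ∧
      (∀ n, 1 * ∏ j ∈ Finset.range (c n), rho a δs U j ≤
        (∏ j ∈ Finset.range (c n), rho a δs V j) * R n) ∧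
      (∀ n, (∏ j ∈ Finset.range (c n), rho a δs V j) * R n ≤
        B * ∏ j ∈ Finset.range (c n), rho a δs U j) := by
  classical
  have hs0 : 0 < s := (hδ0 0).trans_le (hδ 0)
  let r : ℕ → ℝ := fun j => if j ∈ blk a V ∧ j ∉ blk a U then 1 / δs j else 1
  let t : ℕ → ℝ := fun j => if j ∈ blk a U ∧ j ∉ blk a V then 1 / δs j else 1
  have hinv : ∀ j, 1 / s ≤ 1 / δs j := fun j => one_div_le_one_div_of_le (hδ0 j) (hδ j)
  have h1s : 1 < 1 / s := by rw [lt_div_iff₀ hs0]; linarith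
  have hr1 : ∀ j, 1 ≤ r j := by
    intro j; simp only [r]; split_ifs
    · linarith [hinv j]
    · exact le_rfl
  have ht1 : ∀ j, 1 ≤ t j := by
    intro j; simp only [t]; split_ifs
    · linarith [hinv j]
    · exact le_rfl
  have hrt : ∀ j, rho a δs V j * r j = rho a δs U j * t j := by
    intro j
    have h0 := (hδ0 j).ne'
    by_cases h1 : j ∈ blk a U <;> by_cases h2 : j ∈ blk a V <;>
      simp [rho, r, t, h1, h2, h0]
  have hprod1 : ∀ q : ℕ → ℝ, (∀ j, 1 ≤ q j) → ∀ m, 1 ≤ ∏ j ∈ Finset.range m, q j := by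
    intro q hq m
    induction m with
    | zero => simp
    | succ m ih => rw [Finset.prod_range_succ]; exact one_le_mul_of_one_le_of_one_le ih (hq m)
  have hE : ∃ N, ∀ j, N ≤ j → t j = 1 := by
    have hfin : (blk a U \ blk a V).Finite := by
      refine (hUV.biUnion (t := fun l => Ico (a l) (a (l+1))) fun l _ => finite_Ico _ _).subset ?_
      rintro m ⟨⟨l, hl, h1, h2⟩, hm⟩
      refine mem_biUnion (x := l) ⟨hl, fun hlV => hm ⟨l, hlV, h1, h2⟩⟩ ⟨h1, h2⟩
    obtain ⟨N, hN⟩ := hfin.bddAbove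
    refine ⟨N + 1, fun j hj => ?_⟩
    simp only [t]
    rw [if_neg]
    intro h
    have := hN (a := j) ⟨h.1, h.2⟩
    omega
  obtain ⟨N, hN⟩ := hE
  have hρ : ∀ j, 0 < rho a δs U j := by
    intro j; unfold rho; split_ifs
    · exact hδ0 j
    · exact one_pos
  have heq : ∀ n, (∏ j ∈ Finset.range (c n), rho a δs V j) * ∏ j ∈ Finset.range (c n), r j =
      (∏ j ∈ Finset.range (c n), t j) * ∏ j ∈ Finset.range (c n), rho a δs U j := by
    intro n
    rw [← Finset.prod_mul_distrib, ← Finset.prod_mul_distrib]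
    exact Finset.prod_congr rfl fun j _ => by rw [hrt, mul_comm]
  refine ⟨fun n => ∏ j ∈ Finset.range (c n), r j, ∏ j ∈ Finset.range N, t j, ?_,
    ⟨1 / s - 1, by linarith, fun i => ?_⟩, fun n => ?_, fun n => ?_⟩
  · simp [count_zero hc hk0]
  · by_cases h : ∃ m, i + 1 = k m
    · obtain ⟨m, hm⟩ := h
      obtain ⟨h1, h2⟩ := count_succ_of hc hk hm
      simp only [h1, h2]
      rw [Finset.prod_range_succ]
      have hp := hprod1 r hr1 m
      by_cases hb : m ∈ blk a V ∧ m ∉ blk a U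
      · right
        have e1 : r m = 1 / δs m := by simp only [r]; rw [if_pos hb]
        have e2 := hinv m
        rw [e1]
        nlinarith
      · left
        have e1 : r m = 1 := by simp only [r]; rw [if_neg hb]
        rw [e1, mul_one]
    · push Not at h
      left
      simp only [count_succ_of_not hc h]
  · simp only [heq]
    refine mul_le_mul_of_nonneg_right (hprod1 t ht1 _) (Finset.prod_nonneg fun j _ => (hρ j).le)
  · simp only [heq]
    refine mul_le_mul_of_nonneg_right ?_ (Finset.prod_nonneg fun j _ => (hρ j).le)
    have e1 : ∏ j ∈ Finset.range (N + c n), t j = ∏ j ∈ Finset.range N, t j := by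
      rw [Finset.prod_range_add, Finset.prod_eq_one (s := Finset.range (c n)), mul_one]
      intro x _
      exact hN _ (by omega)
    have e2 := Finset.prod_range_add t (c n) N
    rw [add_comm (c n) N, e1] at e2
    rw [e2]
    exact le_mul_of_one_le_right (by linarith [hprod1 t ht1 (c n)])
      (hprod1 (fun x => t (c n + x)) (fun x => ht1 _) N)

theorem stmt12 (α : ℝ) (hα : 1 ≤ α)
    (a : ℕ → ℕ) (ha0 : a 0 = 0) (haS : ∀ l, a (l+1) = a l + 1 + l * a l)
    (δs : ℕ → ℝ) (hδmem : ∀ m, δs m ∈ Ioo (0:ℝ) 1)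
    (hinf : 0 < ⨅ m, δs m) (hsup : (⨆ m, δs m) < 1)
    (k : ℕ → ℕ) (hkmono : StrictMono k) (hk0 : 2 ≤ k 0)
    (hk2 : ∀ m, 2 * k m ≤ k (m+1))
    (u : Set ℕ → ℕ → ℝ) (hu0 : ∀ U, u U 0 = 1)
    (huk : ∀ (U : Set ℕ) (n m l : ℕ), n + 1 = k m → a l ≤ m → m < a (l+1) → l ∈ U →
      u U (n+1) = δs m * u U n)
    (hunk : ∀ (U : Set ℕ) (n : ℕ),
      (¬ ∃ m l, n + 1 = k m ∧ a l ≤ m ∧ m < a (l+1) ∧ l ∈ U) → u U (n+1) = u U n)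
    (φ : ℝ → ℝ) (hφc : ContinuousOn φ (Icc 0 1)) (hφei : EssIncOn φ (Icc 0 1))
    (hφnn : ∀ t ∈ Icc (0:ℝ) 1, 0 ≤ φ t) (hφpos : ∀ t ∈ Ioc (0:ℝ) 1, 0 < φ t)
    (hlam : ∃ lam > (0:ℝ), ∀ t ∈ Icc (0:ℝ) 1, lam * φ t ≤ φ (t^2))
    (φU : Set ℕ → ℝ → ℝ)
    (hφUc : ∀ U, ContinuousOn (φU U) (Icc 0 1))
    (hφUm : ∀ U, MonotoneOn (φU U) (Icc 0 1))
    (hφUnn : ∀ U, ∀ t ∈ Icc (0:ℝ) 1, 0 ≤ φU U t)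
    (hφUval : ∀ U (n : ℕ), φU U ((1/2:ℝ)^n) = u U n)
    :
    (∀ U : Set ℕ, Equivalence (EF (fun t => t ^ α * φ t * φU U t))) ∧
    (∀ U V : Set ℕ, (U \ V).Finite ↔
      BorelReducible (EF (fun t => t ^ α * φ t * φU U t))
        (EF (fun t => t ^ α * φ t * φU V t))) := by
  have hbb : BddBelow (range δs) := ⟨0, by rintro _ ⟨m, rfl⟩; exact (hδmem m).1.le⟩
  have hba : BddAbove (range δs) := ⟨1, by rintro _ ⟨m, rfl⟩; exact (hδmem m).2.le⟩
  have hlo : ∀ m, (⨅ m, δs m) ≤ δs m := fun m => ciInf_le hbb m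
  have hhi : ∀ m, δs m ≤ ⨆ m, δs m := fun m => le_ciSup hba m
  have hlo1 : (⨅ m, δs m) ≤ 1 := (hlo 0).trans (hδmem 0).2.le
  obtain ⟨c, hc⟩ := exists_count hkmono
  have hueq : ∀ U, u U = fun n => ∏ j ∈ Finset.range (c n), rho a δs U j := fun U =>
    u_eq hkmono hk0 hc (hu0 U) (huk U) (hunk U)
  have hus : ∀ U, USeq (u U) := by
    intro U
    rw [hueq]
    refine useq_of hc hk0 hk2 hinf (fun j => ?_) (fun j => ?_)
    · unfold rho; split_ifs
      · exact hlo j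
      · exact hlo1
    · unfold rho; split_ifs
      · exact (hδmem j).2.le
      · exact le_rfl
  have hsl : ∀ U, Slow (fun t => φ t * φU U t) := fun U =>
    slow_of (hus U) hφc hφei hφnn hφpos hlam (hφUc U) (hφUm U) (hφUnn U) (hφUval U)
  have hfn : ∀ U, (fun t => t ^ α * φ t * φU U t) = Fn α (fun t => φ t * φU U t) := by
    intro U; funext t; rw [Fn, mul_assoc]
  simp only [hfn]
  refine ⟨fun U => ?_, fun U V => ⟨fun h => ?_, fun h => ?_⟩⟩
  · obtain ⟨K, hK1, hK⟩ := Fn_tri hα (hsl U)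
    exact EF_equiv (Fn_zero hα _) (Fn_nn (hsl U)) hK
  · obtain ⟨R, B, hR0, hgap, h1, h2⟩ := ratio (a := a) hkmono hk0 hc hsup
      (fun m => (hδmem m).1) hhi h
    have e1 := hueq U
    have e2 := hueq V
    refine part2 hα (hus U) (hus V) hφei hφpos (hφUval U) (hφUval V) (hsl U) (hsl V) hR0 hgap
      one_pos (B := B) ?_ ?_
    · rw [e1, e2]; exact h1
    · rw [e1, e2]; exact h2
  · by_contra hcon
    have e1 := hueq U
    have e2 := hueq V
    refine part3 hα (hus U) (hus V) hφei hφpos (hφUval U) (hφUval V) (hsl U) (hsl V) ?_ h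
    intro B n1
    rw [e1, e2]
    exact sep haS hkmono hc hsup (fun m => (hδmem m).1) hhi hcon B n1
end
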